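/- There exists a constant C > 0 such that for all n ≥ 3 and all integers N ≥ C·n⁴·log n the following holds. Let S_n ⊂ Sym((ℤ/nℤ)²) be the set of states reachable from the identity with positive probability in some number of steps of the n²−1 puzzle chain, and let P^N(id,σ) denote the N-step transition probability from the identity to σ. Then (1/2)·Σ_{σ∈S_n} |P^N(id,σ) − 1/|S_n|| ≤ 1/e; that is, the total variation mixing time of the n²−1 puzzle is O(n⁴ log n). -/

import Mathlib

open Finset

/-- The label of the empty square: `(n−1, n−1)`. -/
def emptyLabel (n : ℕ) : ZMod n × ZMod n := (((n - 1 : ℕ) : ZMod n), ((n - 1 : ℕ) : ZMod n))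

/-- The five displacements `{(0,0),(1,0),(−1,0),(0,1),(0,−1)}` of the empty square. -/
def displacements (n : ℕ) : Finset (ZMod n × ZMod n) :=
  {((0 : ZMod n), (0 : ZMod n)), (1, 0), (-1, 0), (0, 1), (0, -1)}

open Classical in
/-- One-step transition probability of the `n²−1` puzzle chain on `Sym((ℤ/nℤ)²)`:
from the arrangement `σ` a displacement `d` is chosen uniformly among the five
possibilities and `σ` is replaced by `τ ∘ σ`, where `τ` is the transposition of the
positions `σ(b)` and `σ(b) + d` of the board (`b = (n−1,n−1)` the label of the empty
square). -/
noncomputable def puzzleStep (n : ℕ) (σ τ : Equiv.Perm (ZMod n × ZMod n)) : ℝ :=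
  (1 / 5 : ℝ) * (((displacements n).filter
    (fun d => τ = Equiv.swap (σ (emptyLabel n)) (σ (emptyLabel n) + d) * σ)).card : ℝ)

/-- The distribution of the `n²−1` puzzle chain after `N` steps, started at the identity
arrangement. -/
noncomputable def puzzleDist (n : ℕ) [NeZero n] : ℕ → Equiv.Perm (ZMod n × ZMod n) → ℝ
  | 0 => fun τ => if τ = 1 then 1 else 0
  | (N + 1) => fun τ => ∑ σ : Equiv.Perm (ZMod n × ZMod n), puzzleDist n N σ * puzzleStep n σ τ

/-- The set of states of the `n²−1` puzzle reachable from the identity with positive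
probability in some number of steps. -/
def reachable (n : ℕ) [NeZero n] : Set (Equiv.Perm (ZMod n × ZMod n)) :=
  {σ | ∃ N : ℕ, 0 < puzzleDist n N σ}

section Mixing

open scoped Matrix

section
open scoped MatrixOrder

theorem Matrix.PosSemidef.mul_of_commute {G : Type*} [Fintype G] [DecidableEq G]
    {A B : Matrix G G ℝ} (hA : A.PosSemidef) (hB : B.PosSemidef) (h : Commute A B) :
    (A * B).PosSemidef :=
  Matrix.nonneg_iff_posSemidef.1
    (Commute.mul_nonneg (Matrix.nonneg_iff_posSemidef.2 hA) (Matrix.nonneg_iff_posSemidef.2 hB) h)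
end

theorem Matrix.PosSemidef.trace_pow_le {G : Type*} [Fintype G] [DecidableEq G]
    {A B : Matrix G G ℝ} (hA : A.PosSemidef) (hB : B.PosSemidef) (h : (B - A).PosSemidef) (N : ℕ) :
    (A ^ N).trace ≤ (B ^ N).trace := by
  have trace_pow : ∀ {M : Matrix G G ℝ} (hM : M.IsHermitian),
      (M ^ N).trace = ∑ i, hM.eigenvalues i ^ N := by
    intro M hM
    conv_lhs => rw [hM.spectral_theorem, ← map_pow, Unitary.conjStarAlgAut_apply,
      Matrix.trace_mul_cycle]
    simp [Matrix.diagonal_pow, Matrix.trace_diagonal]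
  set u := hA.1.eigenvectorBasis
  set v := hB.1.eigenvectorBasis
  have qA : ∀ i, (u i).ofLp ⬝ᵥ A *ᵥ (u i).ofLp = hA.1.eigenvalues i := by
    intro i
    rw [hA.1.mulVec_eigenvectorBasis, dotProduct_smul]
    have := u.orthonormal.1 i
    have h2 : inner ℝ (u i) (u i) = 1 := by rw [real_inner_self_eq_norm_sq, this]; norm_num
    rw [EuclideanSpace.inner_eq_star_dotProduct] at h2
    simp at h2
    change _ • ((u i).ofLp ⬝ᵥ (u i).ofLp) = _
    simp [h2]
  have qB : ∀ x : EuclideanSpace ℝ G, x.ofLp ⬝ᵥ B *ᵥ x.ofLp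
      = ∑ j, (inner ℝ (v j) x) ^ 2 * hB.1.eigenvalues j := by
    intro x
    have hx : B *ᵥ x.ofLp = ∑ j, (inner ℝ (v j) x * hB.1.eigenvalues j) • (v j).ofLp := by
      conv_lhs => rw [← v.sum_repr' x]
      rw [WithLp.ofLp_sum, Matrix.mulVec_sum]
      refine sum_congr rfl fun j _ => ?_
      rw [WithLp.ofLp_smul, Matrix.mulVec_smul, hB.1.mulVec_eigenvectorBasis, smul_smul]
    rw [hx, dotProduct_sum]
    refine sum_congr rfl fun j _ => ?_
    rw [dotProduct_smul]
    have : inner ℝ (v j) x = x.ofLp ⬝ᵥ (v j).ofLp := by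
      rw [EuclideanSpace.inner_eq_star_dotProduct]; simp
    rw [← this, smul_eq_mul]; ring
  rw [trace_pow hA.1, trace_pow hB.1]
  have w1 : ∀ i, ∑ j, (inner ℝ (v j) (u i)) ^ 2 = 1 := by
    intro i
    have := v.sum_sq_norm_inner_right (u i)
    simpa [u.orthonormal.1 i] using this
  have w2 : ∀ j, ∑ i, (inner ℝ (v j) (u i)) ^ 2 = 1 := by
    intro j
    have := u.sum_sq_norm_inner_left (v j)
    simpa [v.orthonormal.1 j] using this
  calc ∑ i, hA.1.eigenvalues i ^ N
      ≤ ∑ i, ∑ j, (inner ℝ (v j) (u i)) ^ 2 * hB.1.eigenvalues j ^ N := by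
        refine sum_le_sum fun i _ => ?_
        have h1 : hA.1.eigenvalues i ≤ ∑ j, (inner ℝ (v j) (u i)) ^ 2 * hB.1.eigenvalues j := by
          rw [← qA, ← qB]
          have := h.dotProduct_mulVec_nonneg (u i).ofLp
          rw [Matrix.sub_mulVec, dotProduct_sub] at this
          simpa using this
        refine (pow_le_pow_left₀ (hA.eigenvalues_nonneg i) h1 N).trans ?_
        exact Real.pow_arith_mean_le_arith_mean_pow _ _ _ (fun _ _ => sq_nonneg _) (w1 i)
          (fun j _ => hB.eigenvalues_nonneg j) N
    _ = ∑ j, hB.1.eigenvalues j ^ N := by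
        rw [sum_comm]
        refine sum_congr rfl fun j _ => ?_
        rw [← sum_mul, w2, one_mul]

section Regular

open scoped Pointwise

section Displacement

variable {Γ : Type*} [Group Γ] [Fintype Γ]

/-- The `ℓ²` distance between a function and its translate by `g`. -/
noncomputable def disp (f : Γ → ℝ) (g : Γ) : ℝ :=
  ‖WithLp.toLp 2 (fun x => f x - f (g⁻¹ * x))‖

theorem disp_nonneg (f : Γ → ℝ) (g : Γ) : 0 ≤ disp f g := norm_nonneg _

theorem disp_sq (f : Γ → ℝ) (g : Γ) : disp f g ^ 2 = ∑ x, (f x - f (g⁻¹ * x)) ^ 2 := by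
  rw [disp, EuclideanSpace.norm_sq_eq]
  simp

theorem disp_one (f : Γ → ℝ) : disp f 1 = 0 := by
  have h := disp_sq f 1
  simpa using h

theorem disp_mul_le (f : Γ → ℝ) (g h : Γ) : disp f (g * h) ≤ disp f g + disp f h := by
  have key : ‖WithLp.toLp 2 (fun x => f (g⁻¹ * x) - f (h⁻¹ * (g⁻¹ * x)))‖ = disp f h := by
    rw [disp, ← sq_eq_sq₀ (norm_nonneg _) (norm_nonneg _), EuclideanSpace.norm_sq_eq,
      EuclideanSpace.norm_sq_eq]
    exact Equiv.sum_comp (Equiv.mulLeft g⁻¹) (fun x => ‖f x - f (h⁻¹ * x)‖ ^ 2)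
  rw [← key, disp, disp]
  refine le_trans (le_of_eq ?_) (norm_add_le _ _)
  congr 1
  ext x
  simp [mul_assoc]

theorem disp_of_mem_pow (f : Γ → ℝ) {S : Set Γ} {D : ℝ} (hS : ∀ s ∈ S, disp f s ≤ D) {L : ℕ} :
    ∀ {g : Γ}, g ∈ S ^ L → disp f g ≤ L * D := by
  induction L with
  | zero => intro g hg; simp at hg; subst hg; simp [disp_one]
  | succ L ih =>
    intro g hg
    rw [pow_succ] at hg
    obtain ⟨a, ha, b, hb, rfl⟩ := Set.mem_mul.1 hg
    push_cast
    linarith [disp_mul_le f a b, ih ha, hS b hb]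

end Displacement

variable {Γ : Type*} [Group Γ] [Fintype Γ] [DecidableEq Γ]

/-- The left regular representation by permutation matrices. -/
noncomputable def regRep : Γ →* Matrix Γ Γ ℝ where
  toFun g := Matrix.of fun x y => if x = g * y then 1 else 0
  map_one' := by ext x y; simp [Matrix.one_apply]
  map_mul' g h := by
    ext x y
    rw [Matrix.mul_apply]
    simp [mul_assoc]

theorem regRep_apply (g x y : Γ) : regRep g x y = if x = g * y then 1 else 0 := rfl

theorem regRep_mulVec (g : Γ) (f : Γ → ℝ) : regRep g *ᵥ f = fun x => f (g⁻¹ * x) := by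
  ext x
  have : ∀ y, (x = g * y) = (y = g⁻¹ * x) := fun y => by
    rw [eq_inv_mul_iff_mul_eq, eq_comm (a := x)]
  simp [Matrix.mulVec, dotProduct, regRep_apply, this]

theorem vecMul_regRep (g : Γ) (f : Γ → ℝ) : f ᵥ* regRep g = fun x => f (g * x) := by
  ext x
  simp [Matrix.vecMul, dotProduct, regRep_apply]

theorem regRep_transpose (g : Γ) : (regRep g)ᵀ = regRep g⁻¹ := by
  ext x y
  have : (y = g * x) = (x = g⁻¹ * y) := by rw [eq_inv_mul_iff_mul_eq, eq_comm (a := y)]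
  simp [regRep_apply, this]

/-- Matrices commuting with the right regular representation. -/
def convAlg (Γ : Type*) [Group Γ] [Fintype Γ] [DecidableEq Γ] :
    Subalgebra ℝ (Matrix Γ Γ ℝ) where
  carrier := {M | ∀ x y g, M (x * g) (y * g) = M x y}
  mul_mem' := by
    intro A B hA hB x y g
    simp only [Matrix.mul_apply]
    rw [← Equiv.sum_comp (Equiv.mulRight g)]
    exact sum_congr rfl fun z _ => by simp [hA x z g, hB z y g]
  add_mem' := by
    intro A B hA hB x y g
    simp [hA x y g, hB x y g]
  algebraMap_mem' := by
    intro r x y g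
    simp [Matrix.algebraMap_matrix_apply]

theorem regRep_mem_convAlg (g : Γ) : regRep g ∈ convAlg Γ := by
  intro x y h
  simp [regRep_apply, ← mul_assoc]

theorem convAlg_diag {M : Matrix Γ Γ ℝ} (hM : M ∈ convAlg Γ) (x : Γ) : M x x = M 1 1 := by
  simpa using hM 1 1 x

theorem convAlg_trace {M : Matrix Γ Γ ℝ} (hM : M ∈ convAlg Γ) :
    M.trace = Fintype.card Γ * M 1 1 := by
  simp [Matrix.trace, convAlg_diag hM]

theorem convAlg_entry_le {M : Matrix Γ Γ ℝ} (hM : M ∈ convAlg Γ) (hp : M.PosSemidef) (x y : Γ) :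
    M x y ≤ M 1 1 := by
  set v : Γ → ℝ := Pi.single x 1 - Pi.single y 1 with hv
  have h := hp.dotProduct_mulVec_nonneg v
  have hs : M y x = M x y := by simpa using hp.1.apply x y
  rw [star_trivial, hv, Matrix.mulVec_sub, dotProduct_sub, sub_dotProduct, sub_dotProduct] at h
  simp [convAlg_diag hM x, convAlg_diag hM y, hs] at h
  linarith

/-- Matrices supported on the pairs `(x, y)` with `x * y⁻¹` in a given subgroup. -/
def suppAlg (T : Subgroup Γ) : Subalgebra ℝ (Matrix Γ Γ ℝ) where
  carrier := {M | ∀ x y, x * y⁻¹ ∉ T → M x y = 0}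
  mul_mem' := by
    intro A B hA hB x y h
    rw [Matrix.mul_apply]
    refine sum_eq_zero fun z _ => ?_
    by_cases h1 : x * z⁻¹ ∈ T
    · by_cases h2 : z * y⁻¹ ∈ T
      · exact absurd (by simpa using T.mul_mem h1 h2) h
      · rw [hB _ _ h2, mul_zero]
    · rw [hA _ _ h1, zero_mul]
  add_mem' := by
    intro A B hA hB x y h
    simp [hA x y h, hB x y h]
  algebraMap_mem' := by
    intro r x y h
    have : x ≠ y := by rintro rfl; exact h (by simp)
    simp [Matrix.algebraMap_matrix_apply, this]

theorem regRep_mem_suppAlg {T : Subgroup Γ} {g : Γ} (hg : g ∈ T) : regRep g ∈ suppAlg T := by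
  intro x y h
  rw [regRep_apply, if_neg]
  rintro rfl
  exact h (by simpa)

theorem dotProduct_regRep (f : Γ → ℝ) (g : Γ) :
    f ⬝ᵥ regRep g *ᵥ f = f ⬝ᵥ f - disp f g ^ 2 / 2 := by
  rw [disp_sq, regRep_mulVec]
  have : ∑ x, f (g⁻¹ * x) ^ 2 = ∑ x, f x ^ 2 :=
    Equiv.sum_comp (Equiv.mulLeft g⁻¹) (fun x => f x ^ 2)
  simp only [dotProduct]
  have e : ∑ x, (f x - f (g⁻¹ * x)) ^ 2
      = ∑ x, f x ^ 2 + ∑ x, f (g⁻¹ * x) ^ 2 - 2 * ∑ x, f x * f (g⁻¹ * x) := by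
    rw [mul_sum, ← sum_add_distrib, ← sum_sub_distrib]
    exact sum_congr rfl fun x _ => by ring
  rw [e, this]
  have : ∑ x, f x ^ 2 = ∑ x, f x * f x := sum_congr rfl fun x _ => by ring
  rw [this]; ring

/-- The transition matrix of the random walk with uniform increments in `S`. -/
noncomputable def walk (S : Finset Γ) : Matrix Γ Γ ℝ := (#S : ℝ)⁻¹ • ∑ s ∈ S, regRep s

theorem walk_mem_convAlg (S : Finset Γ) : walk S ∈ convAlg Γ :=
  (convAlg Γ).smul_mem (sum_mem fun _ _ => regRep_mem_convAlg _) _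

theorem walk_isHermitian {S : Finset Γ} (hS : ∀ s ∈ S, s⁻¹ ∈ S) : (walk S).IsHermitian := by
  rw [Matrix.IsHermitian, Matrix.conjTranspose_eq_transpose_of_trivial, walk,
    Matrix.transpose_smul, Matrix.transpose_sum]
  congr 1
  refine sum_nbij' (fun s => s⁻¹) (fun s => s⁻¹) hS hS ?_ ?_ ?_ <;> simp [regRep_transpose]

/-- The Dirichlet form of the two-step random walk with increments in `S`. -/
noncomputable def energy (S : Finset Γ) (f : Γ → ℝ) : ℝ :=
  f ⬝ᵥ f - f ⬝ᵥ (walk S * walk S) *ᵥ f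

theorem energy_eq {S : Finset Γ} (hS : S.Nonempty) (f : Γ → ℝ) :
    energy S f = (#S : ℝ)⁻¹ ^ 2 * ∑ s ∈ S, ∑ t ∈ S, disp f (s * t) ^ 2 / 2 := by
  have hc : (#S : ℝ) ≠ 0 := by exact_mod_cast hS.card_pos.ne'
  have : walk S * walk S = (#S : ℝ)⁻¹ ^ 2 • ∑ s ∈ S, ∑ t ∈ S, regRep (s * t) := by
    simp only [walk, Matrix.smul_mul, Matrix.mul_smul, smul_smul, sum_mul_sum, map_mul, pow_two]
  rw [energy, this, Matrix.smul_mulVec, dotProduct_smul, Matrix.sum_mulVec, dotProduct_sum]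
  simp only [Matrix.sum_mulVec, dotProduct_sum, dotProduct_regRep, sum_sub_distrib, sum_const,
    smul_eq_mul, nsmul_eq_mul]
  field_simp
  ring

theorem disp_sq_le_energy {S : Finset Γ} (h1 : 1 ∈ S) (f : Γ → ℝ) {s : Γ} (hs : s ∈ S) :
    disp f s ^ 2 ≤ 2 * (#S : ℝ) ^ 2 * energy S f := by
  have hc : (#S : ℝ) ≠ 0 := by exact_mod_cast (card_pos.2 ⟨1, h1⟩).ne'
  rw [energy_eq ⟨1, h1⟩]
  have : disp f s ^ 2 / 2 ≤ ∑ s ∈ S, ∑ t ∈ S, disp f (s * t) ^ 2 / 2 := by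
    calc disp f s ^ 2 / 2 = disp f (s * 1) ^ 2 / 2 := by rw [mul_one]
      _ ≤ ∑ t ∈ S, disp f (s * t) ^ 2 / 2 :=
        single_le_sum (f := fun t => disp f (s * t) ^ 2 / 2) (fun _ _ => by positivity) h1
      _ ≤ _ := single_le_sum (f := fun s => ∑ t ∈ S, disp f (s * t) ^ 2 / 2)
        (fun _ _ => sum_nonneg fun _ _ => by positivity) hs
  field_simp
  linarith

theorem energy_nonneg {S : Finset Γ} (h1 : 1 ∈ S) (f : Γ → ℝ) : 0 ≤ energy S f := by
  rw [energy_eq ⟨1, h1⟩]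
  positivity

theorem disp_le_energy {S : Finset Γ} (h1 : 1 ∈ S) (f : Γ → ℝ) {L : ℕ} {g : Γ}
    (hg : g ∈ (S : Set Γ) ^ L) : disp f g ^ 2 ≤ (L : ℝ) ^ 2 * (2 * (#S : ℝ) ^ 2 * energy S f) := by
  have hE := energy_nonneg h1 f
  have h := disp_of_mem_pow f (S := (S : Set Γ)) (D := √(2 * (#S : ℝ) ^ 2 * energy S f))
    (fun s hs => Real.le_sqrt_of_sq_le (disp_sq_le_energy h1 f hs)) hg
  calc disp f g ^ 2 ≤ (L * √(2 * (#S : ℝ) ^ 2 * energy S f)) ^ 2 :=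
        pow_le_pow_left₀ (disp_nonneg f g) h 2
    _ = _ := by rw [mul_pow, Real.sq_sqrt (by positivity)]

end Regular

section Levels

open Equiv
open scoped Pointwise

/-- The permutation `i ↦ j ↦ k ↦ i` (for distinct `i`, `j`, `k`). -/
def cyc {α : Type*} [DecidableEq α] (i j k : α) : Perm α := swap i j * swap j k

section Cyc

variable {α : Type*} [DecidableEq α] {i j k : α}

theorem cyc_conj (g : Perm α) (i j k : α) : g * cyc i j k * g⁻¹ = cyc (g i) (g j) (g k) := by
  rw [cyc, cyc, swap_apply_apply, swap_apply_apply]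
  group

theorem cyc_inv (hik : i ≠ k) (hjk : j ≠ k) : (cyc i j k)⁻¹ = cyc j i k := by
  have := swap_apply_apply (swap i j) j k
  rw [swap_apply_right, swap_apply_of_ne_of_ne hik.symm hjk.symm] at this
  rw [cyc, cyc, swap_comm j i, this]
  simp [mul_assoc]

theorem cyc_apply_left (hij : i ≠ j) (hik : i ≠ k) : cyc i j k i = j := by
  simp [cyc, swap_apply_of_ne_of_ne hij hik]

theorem cyc_apply_mid (hik : i ≠ k) (hjk : j ≠ k) : cyc i j k j = k := by
  simp [cyc, swap_apply_of_ne_of_ne hik.symm hjk.symm]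

theorem cyc_apply_right : cyc i j k k = i := by
  simp [cyc]

theorem cyc_apply_of_ne {x : α} (h1 : x ≠ i) (h2 : x ≠ j) (h3 : x ≠ k) : cyc i j k x = x := by
  simp [cyc, swap_apply_of_ne_of_ne, h1, h2, h3]

theorem cyc_rotate (hik : i ≠ k) (hij : i ≠ j) : cyc i j k = cyc j k i := by
  have := swap_apply_apply (swap j k) i j
  rw [swap_apply_left, swap_apply_of_ne_of_ne hij hik] at this
  rw [cyc, cyc, swap_comm k i, this]
  simp [mul_assoc]

end Cyc

variable {m : ℕ} {B : Type*} [Group B] [Fintype B] [DecidableEq B]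

/-- The matrix of the lazy random walk whose increments are uniform among the 3-cycles of which
`k` is the largest moved point; the increments are nontrivial with probability `ε`. -/
noncomputable def level (B : Type*) [Group B] [Fintype B] [DecidableEq B] (ε : ℝ) (k : Fin m) :
    Matrix (Perm (Fin m) × B) (Perm (Fin m) × B) ℝ :=
  1 - (ε / #(Iio k).offDiag) • ∑ p ∈ (Iio k).offDiag, (1 - regRep (cyc p.1 p.2 k, (1 : B)))

theorem level_mem {ε : ℝ} {k : Fin m}
    {A : Subalgebra ℝ (Matrix (Perm (Fin m) × B) (Perm (Fin m) × B) ℝ)}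
    (h : ∀ p ∈ (Iio k).offDiag, regRep (cyc p.1 p.2 k, (1 : B)) ∈ A) : level B ε k ∈ A :=
  sub_mem (one_mem _) (A.smul_mem (sum_mem fun p hp => sub_mem (one_mem _) (h p hp)) _)

theorem level_commute_regRep (ε : ℝ) {k : Fin m} {g : Perm (Fin m)} (hk : g k = k)
    (hg : ∀ i, g i < k ↔ i < k) : Commute (level B ε k) (regRep (g, (1 : B))) := by
  refine Commute.sub_left (Commute.one_left _) (Commute.smul_left ?_ _)
  rw [Commute, SemiconjBy, sum_mul, mul_sum]
  refine sum_nbij' (fun p => (g⁻¹ p.1, g⁻¹ p.2)) (fun p => (g p.1, g p.2)) ?_ ?_ ?_ ?_ ?_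
  · intro p hp
    have h1 := hg (g⁻¹ p.1)
    have h2 := hg (g⁻¹ p.2)
    simp_all
  · intro p hp
    simp_all
  · simp
  · simp
  · intro p hp
    simp only [sub_mul, mul_sub, one_mul, mul_one, ← map_mul]
    have : g * cyc (g⁻¹ p.1) (g⁻¹ p.2) k = cyc p.1 p.2 k * g := by
      rw [← mul_inv_eq_iff_eq_mul, cyc_conj, hk, ← Perm.mul_apply, ← Perm.mul_apply,
        mul_inv_cancel, Perm.one_apply, Perm.one_apply]
    rw [Prod.mk_mul_mk, Prod.mk_mul_mk, this]

theorem level_commute_level (ε : ℝ) {j k : Fin m} (h : j < k) :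
    Commute (level B ε j) (level B ε k) := by
  have : level B ε j ∈ Subalgebra.centralizer ℝ {level B ε k} := by
    refine level_mem fun p hp => ?_
    rw [Subalgebra.mem_centralizer_iff]
    rintro _ rfl
    simp only [mem_offDiag, mem_Iio] at hp
    have h1 : p.1 < k := hp.1.trans h
    have h2 : p.2 < k := hp.2.1.trans h
    refine level_commute_regRep ε (cyc_apply_of_ne h1.ne' h2.ne' h.ne') fun i => ?_
    by_cases e1 : i = p.1
    · subst e1; rw [cyc_apply_left hp.2.2 hp.1.ne]; simp [h1, h2]
    by_cases e2 : i = p.2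
    · subst e2; rw [cyc_apply_mid hp.1.ne hp.2.1.ne]; simp [h, h2]
    by_cases e3 : i = j
    · subst e3; rw [cyc_apply_right]; simp [h, h1]
    rw [cyc_apply_of_ne e1 e2 e3]
  exact ((Subalgebra.mem_centralizer_iff ℝ).1 this _ rfl).symm

theorem level_isHermitian (ε : ℝ) (k : Fin m) : (level B ε k).IsHermitian := by
  rw [Matrix.IsHermitian, Matrix.conjTranspose_eq_transpose_of_trivial, level,
    Matrix.transpose_sub, Matrix.transpose_smul, Matrix.transpose_sum, Matrix.transpose_one]
  congr 2
  refine sum_nbij' Prod.swap Prod.swap ?_ ?_ ?_ ?_ ?_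
  · intro p hp; simp_all [eq_comm]
  · intro p hp; simp_all [eq_comm]
  · simp
  · simp
  · intro p hp
    simp only [mem_offDiag, mem_Iio] at hp
    rw [Matrix.transpose_sub, Matrix.transpose_one, regRep_transpose]
    simp [cyc_inv hp.1.ne hp.2.1.ne]

theorem one_sub_level_form (ε : ℝ) (k : Fin m) (f : Perm (Fin m) × B → ℝ) :
    f ⬝ᵥ (1 - level B ε k) *ᵥ f = (ε / #(Iio k).offDiag) *
      ∑ p ∈ (Iio k).offDiag, disp f (cyc p.1 p.2 k, (1 : B)) ^ 2 / 2 := by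
  rw [level, sub_sub_cancel, Matrix.smul_mulVec, dotProduct_smul, Matrix.sum_mulVec,
    dotProduct_sum, smul_eq_mul]
  congr 1
  refine sum_congr rfl fun p _ => ?_
  rw [Matrix.sub_mulVec, dotProduct_sub, Matrix.one_mulVec, dotProduct_regRep]
  ring

theorem one_sub_level_posSemidef {ε : ℝ} (hε : 0 ≤ ε) (k : Fin m) :
    (1 - level B ε k).PosSemidef := by
  refine .of_dotProduct_mulVec_nonneg (Matrix.isHermitian_one.sub (level_isHermitian ε k))
    fun f => ?_
  rw [star_trivial, one_sub_level_form]
  positivity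

theorem one_sub_level_form_le {ε : ℝ} (hε : 0 ≤ ε) (k : Fin m) (f : Perm (Fin m) × B → ℝ) {D : ℝ}
    (hD : 0 ≤ D) (h : ∀ p ∈ (Iio k).offDiag, disp f (cyc p.1 p.2 k, (1 : B)) ^ 2 ≤ D) :
    f ⬝ᵥ (1 - level B ε k) *ᵥ f ≤ ε * (D / 2) := by
  rw [one_sub_level_form]
  rcases (Iio k).offDiag.eq_empty_or_nonempty with h0 | h0
  · rw [h0]; simp; positivity
  have hc : (0 : ℝ) < #(Iio k).offDiag := by exact_mod_cast h0.card_pos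
  calc _ ≤ (ε / #(Iio k).offDiag) * ∑ p ∈ (Iio k).offDiag, D / 2 := by
        gcongr with p hp
        exact h p hp
    _ = _ := by rw [sum_const, nsmul_eq_mul]; field_simp

theorem disp_sq_le {Γ : Type*} [Group Γ] [Fintype Γ] [DecidableEq Γ] (f : Γ → ℝ) (g : Γ) :
    disp f g ^ 2 ≤ 4 * (f ⬝ᵥ f) := by
  rw [disp_sq]
  have : ∑ x, f (g⁻¹ * x) ^ 2 = ∑ x, f x ^ 2 :=
    Equiv.sum_comp (Equiv.mulLeft g⁻¹) (fun x => f x ^ 2)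
  calc _ ≤ ∑ x, (2 * f x ^ 2 + 2 * f (g⁻¹ * x) ^ 2) :=
        sum_le_sum fun x _ => by nlinarith [sq_nonneg (f x + f (g⁻¹ * x))]
    _ = 4 * (f ⬝ᵥ f) := by
      rw [sum_add_distrib, ← mul_sum, ← mul_sum, this, dotProduct]
      simp only [← pow_two]
      ring

theorem level_posSemidef {ε : ℝ} (hε : 0 ≤ ε) (hε' : ε ≤ 1 / 2) (k : Fin m) :
    (level B ε k).PosSemidef := by
  refine .of_dotProduct_mulVec_nonneg (level_isHermitian ε k) fun f => ?_
  have hf : 0 ≤ f ⬝ᵥ f := sum_nonneg fun x _ => mul_self_nonneg (f x)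
  have h := one_sub_level_form_le hε k f (by positivity) fun p _ => disp_sq_le f _
  rw [Matrix.sub_mulVec, dotProduct_sub, Matrix.one_mulVec] at h
  rw [star_trivial]
  nlinarith

theorem level_apply_nonneg {ε : ℝ} (hε : 0 ≤ ε) (hε' : ε ≤ 1) (k : Fin m)
    (x y : Perm (Fin m) × B) : 0 ≤ level B ε k x y := by
  rcases (Iio k).offDiag.eq_empty_or_nonempty with h0 | h0
  · simp only [level, h0, sum_empty, smul_zero, sub_zero, Matrix.one_apply]
    positivity
  have hc : (#(Iio k).offDiag : ℝ) ≠ 0 := by exact_mod_cast h0.card_pos.ne'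
  have : level B ε k = (1 - ε) • 1 + (ε / #(Iio k).offDiag) • ∑ p ∈ (Iio k).offDiag,
      regRep (cyc p.1 p.2 k, (1 : B)) := by
    rw [level, sum_sub_distrib, sum_const, smul_sub, ← Nat.cast_smul_eq_nsmul ℝ, smul_smul,
      div_mul_cancel₀ _ hc, sub_smul, one_smul]
    abel
  rw [this, Matrix.add_apply, Matrix.smul_apply, Matrix.smul_apply, Matrix.sum_apply]
  have h1 : 0 ≤ (1 : Matrix (Perm (Fin m) × B) (Perm (Fin m) × B) ℝ) x y := by
    rw [Matrix.one_apply]; positivity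
  have h2 : 0 ≤ ∑ p ∈ (Iio k).offDiag, regRep (cyc p.1 p.2 k, (1 : B)) x y :=
    sum_nonneg fun p _ => by rw [regRep_apply]; positivity
  have h3 : 0 ≤ 1 - ε := by linarith
  simp only [smul_eq_mul]
  positivity

theorem pow_apply_nonneg {Γ : Type*} [Fintype Γ] [DecidableEq Γ] {M : Matrix Γ Γ ℝ}
    (h : ∀ x y, 0 ≤ M x y) (N : ℕ) : ∀ x y, 0 ≤ (M ^ N) x y := by
  induction N with
  | zero => intro x y; rw [pow_zero, Matrix.one_apply]; positivity
  | succ N ih =>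
    intro x y
    rw [pow_succ, Matrix.mul_apply]
    exact sum_nonneg fun z _ => mul_nonneg (ih _ _) (h _ _)

theorem sum_pow_level_apply {ε : ℝ} {k : Fin m} (hk : 2 ≤ (k : ℕ)) (N : ℕ) :
    ∑ y : Perm (Fin m) × B, (if y.1 k = k then 1 else 0) * (level B ε k ^ N) y 1
      = 1 / (k + 1) + k / (k + 1) * (1 - ε - ε / k) ^ N := by
  have hq : (2 : ℝ) ≤ k := by exact_mod_cast hk
  set θ : ℝ := 1 - ε - ε / k
  set φ : Perm (Fin m) × B → ℝ := fun y => if y.1 k = k then 1 else 0 with hφ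
  set ψ : Perm (Fin m) × B → ℝ := fun y => if y.1 k ≤ k then 1 else 0 with hψ
  have hcard : (#(Iio k).offDiag : ℝ) = k * (k - 1) := by
    rw [offDiag_card, Fin.card_Iio, Nat.cast_sub (Nat.le_mul_self _)]
    push_cast; ring
  have hne : (#(Iio k).offDiag : ℝ) ≠ 0 := by rw [hcard]; nlinarith
  have act : ∀ (f : Perm (Fin m) × B → ℝ) (y : Perm (Fin m) × B), (f ᵥ* level B ε k) y = f y -
      ε / #(Iio k).offDiag * ∑ p ∈ (Iio k).offDiag, (f y - f ((cyc p.1 p.2 k, 1) * y)) := by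
    intro f y
    rw [level, Matrix.vecMul_sub, Matrix.vecMul_smul, Matrix.vecMul_sum]
    simp [Matrix.vecMul_sub, vecMul_regRep]
  have hψl : ψ ᵥ* level B ε k = ψ := by
    ext y
    rw [act, sum_eq_zero, mul_zero, sub_zero]
    intro p hp
    simp only [mem_offDiag, mem_Iio] at hp
    have : cyc p.1 p.2 k (y.1 k) ≤ k ↔ y.1 k ≤ k := by
      by_cases e1 : y.1 k = p.1
      · rw [e1, cyc_apply_left hp.2.2 hp.1.ne]; simp [hp.1.le, hp.2.1.le]
      by_cases e2 : y.1 k = p.2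
      · rw [e2, cyc_apply_mid hp.1.ne hp.2.1.ne]; simp [hp.2.1.le]
      by_cases e3 : y.1 k = k
      · rw [e3, cyc_apply_right]; simp [hp.1.le]
      rw [cyc_apply_of_ne e1 e2 e3]
    simp [hψ, this]
  have hφl : φ ᵥ* level B ε k = θ • φ + (ε / k) • ψ := by
    ext y
    rw [act, hcard]
    rcases lt_trichotomy (y.1 k) k with h | h | h
    · have h1 : ∑ p ∈ (Iio k).offDiag, (φ y - φ ((cyc p.1 p.2 k, 1) * y)) = -(k - 1) := by
        have : ∀ p ∈ (Iio k).offDiag, φ y - φ ((cyc p.1 p.2 k, 1) * y)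
            = -(if p.2 = y.1 k then 1 else 0) := by
          intro p hp
          simp only [mem_offDiag, mem_Iio] at hp
          simp only [hφ, h.ne, if_false, Prod.fst_mul, Perm.mul_apply, zero_sub]
          congr 2
          apply propext
          constructor
          · intro e
            apply (cyc p.1 p.2 k).injective
            rw [e, cyc_apply_mid hp.1.ne hp.2.1.ne]
          · rintro e
            rw [← e, cyc_apply_mid hp.1.ne hp.2.1.ne]
        rw [sum_congr rfl this, sum_neg_distrib, sum_boole]
        have e : (Iio k).offDiag.filter (fun p => p.2 = y.1 k)
            = ((Iio k).erase (y.1 k)).map ⟨fun i => (i, y.1 k), fun _ _ => by simp⟩ := by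
          ext ⟨a, b⟩
          simp only [mem_filter, mem_offDiag, mem_Iio, mem_map, mem_erase]
          constructor
          · rintro ⟨⟨h1, h2, h3⟩, rfl⟩
            exact ⟨a, ⟨h3, h1⟩, rfl⟩
          · rintro ⟨a', ⟨h3, h1⟩, h⟩
            cases h
            exact ⟨⟨h1, h, h3⟩, rfl⟩
        rw [e, card_map, card_erase_of_mem (by simpa using h), Fin.card_Iio]
        rw [Nat.cast_sub (by omega)]
        simp
      rw [h1]
      have : φ y = 0 := by simp [hφ, h.ne]
      have h2 : ψ y = 1 := by simp [hψ, h.le]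
      simp only [Pi.add_apply, Pi.smul_apply, this, h2, smul_eq_mul]
      have hk1 : (k : ℝ) - 1 ≠ 0 := by linarith
      have hk0 : (k : ℝ) ≠ 0 := by linarith
      field_simp
      ring
    · have h1 : ∑ p ∈ (Iio k).offDiag, (φ y - φ ((cyc p.1 p.2 k, 1) * y)) = k * (k - 1) := by
        rw [← hcard, ← nsmul_one, ← sum_const]
        refine sum_congr rfl fun p hp => ?_
        simp only [mem_offDiag, mem_Iio] at hp
        simp [hφ, h, cyc_apply_right, hp.1.ne]
      rw [h1]
      have : φ y = 1 := by simp [hφ, h]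
      have h2 : ψ y = 1 := by simp [hψ, h]
      simp only [Pi.add_apply, Pi.smul_apply, this, h2, smul_eq_mul, θ]
      have hk1 : (k : ℝ) - 1 ≠ 0 := by linarith
      have hk0 : (k : ℝ) ≠ 0 := by linarith
      field_simp
      ring
    · have h1 : ∑ p ∈ (Iio k).offDiag, (φ y - φ ((cyc p.1 p.2 k, 1) * y)) = 0 := by
        refine sum_eq_zero fun p hp => ?_
        simp only [mem_offDiag, mem_Iio] at hp
        have := cyc_apply_of_ne (hp.1.trans h).ne' (hp.2.1.trans h).ne' h.ne'
        simp [hφ, h.ne', this]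
      rw [h1]
      have : φ y = 0 := by simp [hφ, h.ne']
      have h2 : ψ y = 0 := by simp [hψ, h]
      simp [this, h2]
  have main : ∀ N : ℕ, φ ᵥ* level B ε k ^ N = θ ^ N • φ + ((1 - θ ^ N) / (k + 1)) • ψ := by
    intro N
    induction N with
    | zero => simp
    | succ N ih =>
      rw [pow_succ, ← Matrix.vecMul_vecMul, ih, Matrix.add_vecMul, Matrix.smul_vecMul,
        Matrix.smul_vecMul, hψl, hφl, smul_add, smul_smul, smul_smul, add_assoc, ← add_smul,
        ← pow_succ]
      congr 2
      have hk1 : (k : ℝ) - 1 ≠ 0 := by linarith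
      have hk0 : (k : ℝ) ≠ 0 := by linarith
      have : (k : ℝ) + 1 ≠ 0 := by linarith
      simp only [θ, pow_succ]
      field_simp
      ring
  have := congrFun (main N) 1
  have e1 : φ 1 = 1 := by simp [hφ]
  have e2 : ψ 1 = 1 := by simp [hψ]
  simp only [Pi.add_apply, Pi.smul_apply, e1, e2, smul_eq_mul, Matrix.vecMul, dotProduct] at this
  rw [this]
  have : (k : ℝ) + 1 ≠ 0 := by linarith
  field_simp
  ring

end Levels

section LevelProd

open Equiv

variable {m : ℕ} {B : Type*} [Group B] [Fintype B] [DecidableEq B]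

/-- The product of the matrices `level B ε k` over `k < q`. -/
noncomputable def levelProd (m : ℕ) (B : Type*) [Group B] [Fintype B] [DecidableEq B] (ε : ℝ) :
    ℕ → Matrix (Perm (Fin m) × B) (Perm (Fin m) × B) ℝ
  | 0 => 1
  | q + 1 => levelProd m B ε q * if h : q < m then level B ε ⟨q, h⟩ else 1

theorem levelProd_succ (ε : ℝ) {q : ℕ} (h : q < m) :
    levelProd m B ε (q + 1) = levelProd m B ε q * level B ε ⟨q, h⟩ := by
  rw [levelProd, dif_pos h]

theorem levelProd_mem {ε : ℝ}
    {A : Subalgebra ℝ (Matrix (Perm (Fin m) × B) (Perm (Fin m) × B) ℝ)} {q : ℕ}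
    (h : ∀ k : Fin m, (k : ℕ) < q → level B ε k ∈ A) : levelProd m B ε q ∈ A := by
  induction q with
  | zero => exact one_mem _
  | succ q ih =>
    refine mul_mem (ih fun k hk => h k (hk.trans q.lt_succ_self)) ?_
    split_ifs with hq
    · exact h _ q.lt_succ_self
    · exact one_mem _

theorem levelProd_commute_level (ε : ℝ) {q : ℕ} {k : Fin m} (hk : q ≤ k) :
    Commute (levelProd m B ε q) (level B ε k) := by
  have : levelProd m B ε q ∈ Subalgebra.centralizer ℝ {level B ε k} := by
    refine levelProd_mem fun j hj => ?_
    rw [Subalgebra.mem_centralizer_iff]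
    rintro _ rfl
    exact (level_commute_level ε (Fin.lt_def.2 (hj.trans_le hk))).symm
  exact ((Subalgebra.mem_centralizer_iff ℝ).1 this _ rfl).symm

theorem levelProd_mem_convAlg (ε : ℝ) (q : ℕ) : levelProd m B ε q ∈ convAlg (Perm (Fin m) × B) :=
  levelProd_mem fun _ _ => level_mem fun _ _ => regRep_mem_convAlg _

theorem levelProd_posSemidef {ε : ℝ} (hε : 0 ≤ ε) (hε' : ε ≤ 1 / 2) {q : ℕ} (hq : q ≤ m) :
    (levelProd m B ε q).PosSemidef := by
  induction q with
  | zero => exact .one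
  | succ q ih =>
    rw [levelProd_succ ε hq]
    exact (ih (by omega)).mul_of_commute (level_posSemidef hε hε' _)
      (levelProd_commute_level ε le_rfl)

theorem one_sub_levelProd_posSemidef {ε : ℝ} (hε : 0 ≤ ε) (hε' : ε ≤ 1 / 2) {q : ℕ} (hq : q ≤ m) :
    (1 - levelProd m B ε q).PosSemidef := by
  induction q with
  | zero => rw [levelProd, sub_self]; exact .zero
  | succ q ih =>
    have : 1 - levelProd m B ε (q + 1) = (1 - levelProd m B ε q)
        + levelProd m B ε q * (1 - level B ε ⟨q, hq⟩) := by
      rw [levelProd_succ ε hq]; noncomm_ring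
    rw [this]
    exact (ih (by omega)).add ((levelProd_posSemidef hε hε' (by omega)).mul_of_commute
      (one_sub_level_posSemidef hε _)
      ((Commute.one_right _).sub_right (levelProd_commute_level ε le_rfl)))

theorem one_sub_levelProd_form_le {ε : ℝ} (hε : 0 ≤ ε) (hε' : ε ≤ 1 / 2)
    (f : Perm (Fin m) × B → ℝ) {D : ℝ} (hD : 0 ≤ D)
    (h : ∀ i j k : Fin m, i ≠ j → i ≠ k → j ≠ k → disp f (cyc i j k, (1 : B)) ^ 2 ≤ D)
    {q : ℕ} (hq : q ≤ m) :
    f ⬝ᵥ (1 - levelProd m B ε q) *ᵥ f ≤ q * (ε * (D / 2)) := by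
  induction q with
  | zero => simp [levelProd]
  | succ q ih =>
    have e : 1 - levelProd m B ε (q + 1) = (1 - levelProd m B ε q) + (1 - level B ε ⟨q, hq⟩)
        - (1 - levelProd m B ε q) * (1 - level B ε ⟨q, hq⟩) := by
      rw [levelProd_succ ε hq]; noncomm_ring
    have hp : ((1 - levelProd m B ε q) * (1 - level B ε ⟨q, hq⟩)).PosSemidef :=
      (one_sub_levelProd_posSemidef hε hε' (by omega)).mul_of_commute
        (one_sub_level_posSemidef hε _)
        (((Commute.one_right _).sub_right ((Commute.one_left _).sub_left
          (levelProd_commute_level ε le_rfl))))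
    have h1 := hp.dotProduct_mulVec_nonneg f
    have h2 := ih (by omega)
    have h3 := one_sub_level_form_le (B := B) hε ⟨q, hq⟩ f hD fun p hp => by
      simp only [mem_offDiag, mem_Iio] at hp
      exact h _ _ _ hp.2.2 hp.1.ne hp.2.1.ne
    rw [star_trivial] at h1
    rw [e, Matrix.sub_mulVec, Matrix.add_mulVec, dotProduct_sub, dotProduct_add]
    push_cast
    linarith

theorem levelProd_apply_nonneg {ε : ℝ} (hε : 0 ≤ ε) (hε' : ε ≤ 1) {q : ℕ} (hq : q ≤ m)
    (x y : Perm (Fin m) × B) : 0 ≤ levelProd m B ε q x y := by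
  induction q generalizing x y with
  | zero => rw [levelProd, Matrix.one_apply]; positivity
  | succ q ih =>
    rw [levelProd_succ ε hq, Matrix.mul_apply]
    exact sum_nonneg fun z _ => mul_nonneg (ih (by omega) _ _) (level_apply_nonneg hε hε' _ _ _)

theorem levelProd_pow_apply_eq_zero (ε : ℝ) {q : ℕ} {k : Fin m} (hk : q ≤ k) (N : ℕ)
    {y : Perm (Fin m) × B} (hy : y.1 k ≠ k) : (levelProd m B ε q ^ N) 1 y = 0 := by
  set T : Subgroup (Perm (Fin m) × B) := (MulAction.stabilizer (Perm (Fin m)) k).prod ⊤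
  have h : levelProd m B ε q ∈ suppAlg T := by
    refine levelProd_mem fun j hj => level_mem fun p hp => regRep_mem_suppAlg ?_
    have hj' : j < k := Fin.lt_def.2 (hj.trans_le hk)
    simp only [mem_offDiag, mem_Iio] at hp
    refine Subgroup.mem_prod.2 ⟨?_, Subgroup.mem_top _⟩
    exact cyc_apply_of_ne (hp.1.trans hj').ne' (hp.2.1.trans hj').ne' hj'.ne'
  refine pow_mem h N 1 y fun hm => hy ?_
  rw [one_mul] at hm
  exact (Subgroup.mem_prod.1 (inv_mem_iff.1 hm)).1

theorem levelProd_pow_succ_apply_le {ε : ℝ} (hε : 0 ≤ ε) (hε' : ε ≤ 1 / 2) {q : ℕ} (hq : q < m)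
    (h2 : 2 ≤ q) (N : ℕ) :
    (levelProd m B ε (q + 1) ^ N) 1 1
      ≤ (levelProd m B ε q ^ N) 1 1 * ((1 + q * Real.exp (-(ε * N))) / (q + 1)) := by
  set k : Fin m := ⟨q, hq⟩
  have hq2 : (2 : ℝ) ≤ q := by exact_mod_cast h2
  have hpsd : (levelProd m B ε q ^ N).PosSemidef := (levelProd_posSemidef hε hε' hq.le).pow N
  have hmem : levelProd m B ε q ^ N ∈ convAlg (Perm (Fin m) × B) :=
    pow_mem (levelProd_mem_convAlg ε q) N
  have h0 : 0 ≤ (levelProd m B ε q ^ N) 1 1 :=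
    pow_apply_nonneg (levelProd_apply_nonneg hε (by linarith) hq.le) N 1 1
  rw [levelProd_succ ε hq, (levelProd_commute_level ε (le_refl (k : ℕ))).mul_pow, Matrix.mul_apply]
  calc ∑ y, (levelProd m B ε q ^ N) 1 y * (level B ε k ^ N) y 1
      ≤ ∑ y : Perm (Fin m) × B, (levelProd m B ε q ^ N) 1 1 *
          ((if y.1 k = k then 1 else 0) * (level B ε k ^ N) y 1) := by
        refine sum_le_sum fun y _ => ?_
        have hn := pow_apply_nonneg (level_apply_nonneg (B := B) hε (by linarith) k) N y 1
        split_ifs with hy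
        · rw [one_mul]
          exact mul_le_mul_of_nonneg_right (convAlg_entry_le hmem hpsd 1 y) hn
        · rw [levelProd_pow_apply_eq_zero ε le_rfl N hy]; simp
    _ = (levelProd m B ε q ^ N) 1 1 * (1 / (q + 1) + q / (q + 1) * (1 - ε - ε / q) ^ N) := by
        rw [← mul_sum, sum_pow_level_apply h2]
    _ ≤ _ := by
        refine mul_le_mul_of_nonneg_left ?_ h0
        have h3 : ε / q ≤ 1 / 2 := by
          rw [div_le_iff₀ (by linarith)]; nlinarith
        have h4 : 0 ≤ ε / q := by positivity
        have h5 : (1 - ε - ε / q) ^ N ≤ Real.exp (-(ε * N)) := by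
          calc (1 - ε - ε / q) ^ N ≤ Real.exp (-ε) ^ N := by
                refine pow_le_pow_left₀ (by linarith) ?_ N
                linarith [Real.add_one_le_exp (-ε)]
            _ = _ := by rw [← Real.exp_nat_mul]; congr 1; ring
        rw [add_div, mul_div_right_comm]
        gcongr

theorem levelProd_two (ε : ℝ) : levelProd m B ε 2 = 1 := by
  have h : ∀ k : Fin m, (k : ℕ) < 2 → level B ε k = 1 := by
    intro k hk
    have : (Iio k).offDiag = ∅ := by
      rw [← card_eq_zero, offDiag_card, Fin.card_Iio]
      interval_cases (k : ℕ) <;> rfl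
    rw [level, this]; simp
  rw [levelProd, levelProd, levelProd]
  split_ifs <;> simp [h]

theorem levelProd_pow_apply_le {ε : ℝ} (hε : 0 ≤ ε) (hε' : ε ≤ 1 / 2) (N : ℕ) {q : ℕ}
    (h2 : 2 ≤ q) (hq : q ≤ m) : (levelProd m B ε q ^ N) 1 1 * q.factorial
      ≤ 2 * Real.exp ((q : ℝ) ^ 2 * Real.exp (-(ε * N))) := by
  induction q, h2 using Nat.le_induction with
  | base =>
    rw [levelProd_two]
    have : 1 ≤ Real.exp (((2 : ℕ) : ℝ) ^ 2 * Real.exp (-(ε * N))) :=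
      Real.one_le_exp (by positivity)
    simpa using this
  | succ q h2 ih =>
    set E := Real.exp (-(ε * N)) with hE
    have hE0 : 0 < E := Real.exp_pos _
    have h0 : 0 ≤ (levelProd m B ε q ^ N) 1 1 :=
      pow_apply_nonneg (levelProd_apply_nonneg hε (by linarith) (by omega)) N 1 1
    calc (levelProd m B ε (q + 1) ^ N) 1 1 * ((q + 1).factorial : ℕ)
        ≤ ((levelProd m B ε q ^ N) 1 1 * ((1 + q * E) / (q + 1))) * ((q + 1).factorial : ℕ) := by
          gcongr
          exact levelProd_pow_succ_apply_le hε hε' hq h2 N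
      _ = ((levelProd m B ε q ^ N) 1 1 * q.factorial) * (q * E + 1) := by
          rw [Nat.factorial_succ]; push_cast; field_simp; ring
      _ ≤ (2 * Real.exp ((q : ℝ) ^ 2 * E)) * Real.exp (q * E) := by
          exact mul_le_mul (ih (by omega)) (Real.add_one_le_exp _) (by positivity) (by positivity)
      _ = 2 * Real.exp ((q : ℝ) ^ 2 * E + q * E) := by rw [mul_assoc, ← Real.exp_add]
      _ ≤ _ := by
          gcongr
          push_cast
          have : (0 : ℝ) ≤ q := by positivity
          nlinarith

end LevelProd

section Covering

open scoped Pointwise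

variable {Γ : Type*} [Group Γ]

theorem mem_closure_iff_exists_pow {S : Finset Γ} (hS : ∀ s ∈ S, s⁻¹ ∈ S) {g : Γ} :
    g ∈ Subgroup.closure (S : Set Γ) ↔ ∃ N : ℕ, g ∈ (S : Set Γ) ^ N := by
  constructor
  · intro hg
    induction hg using Subgroup.closure_induction with
    | mem x hx => exact ⟨1, by simpa using hx⟩
    | one => exact ⟨0, by simp⟩
    | mul x y _ _ hx hy =>
      obtain ⟨a, ha⟩ := hx
      obtain ⟨b, hb⟩ := hy
      exact ⟨a + b, by rw [pow_add]; exact Set.mul_mem_mul ha hb⟩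
    | inv x _ hx =>
      obtain ⟨a, ha⟩ := hx
      have : (S : Set Γ)⁻¹ = S := by
        ext y
        exact ⟨fun hy => by simpa using hS _ hy, fun hy => hS _ hy⟩
      exact ⟨a, by rw [← this, inv_pow]; simpa using ha⟩
  · rintro ⟨N, hN⟩
    induction N generalizing g with
    | zero => simp at hN; rw [hN]; exact one_mem _
    | succ N ih =>
      rw [pow_succ] at hN
      obtain ⟨a, ha, b, hb, rfl⟩ := Set.mem_mul.1 hN
      exact mul_mem (ih ha) (Subgroup.subset_closure hb)

theorem exists_mem_pow_index_mul [Finite Γ] {H : Subgroup Γ} [H.Normal] {S : Finset Γ}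
    (h1 : 1 ∈ S) (hS : ∀ s ∈ S, s⁻¹ ∈ S)
    {g : Γ} (hg : g ∈ Subgroup.closure (S : Set Γ)) :
    ∃ w ∈ (S : Set Γ) ^ H.index, ∃ h ∈ H, g = w * h := by
  obtain ⟨N, hN⟩ := (mem_closure_iff_exists_pow hS).1 hg
  set T : Set (Γ ⧸ H) := QuotientGroup.mk' H '' (S : Set Γ) with hT
  have hTpow : ∀ j : ℕ, T ^ j = QuotientGroup.mk' H '' ((S : Set Γ) ^ j) := fun j =>
    (Set.image_pow (QuotientGroup.mk' H) _ j).symm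
  have hT1 : (1 : Γ ⧸ H) ∈ T := ⟨1, h1, map_one _⟩
  have key : T ^ N ⊆ T ^ H.index := by
    rcases le_total N H.index with h | h
    · exact Set.pow_subset_pow_right hT1 h
    · classical
      cases nonempty_fintype Γ
      have hi : H.index = Fintype.card (Γ ⧸ H) := by
        rw [Subgroup.index_eq_card, Nat.card_eq_fintype_card]
      have e := Group.card_pow_eq_card_pow_card_univ T N (hi ▸ h)
      have hs : T ^ H.index ⊆ T ^ N := Set.pow_subset_pow_right hT1 h
      refine (Set.eq_of_subset_of_card_le hs ?_).ge
      simp [e, hi]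
  have h2 : QuotientGroup.mk' H g ∈ T ^ H.index := key (by rw [hTpow]; exact ⟨g, hN, rfl⟩)
  rw [hTpow] at h2
  obtain ⟨w, hw, e⟩ := h2
  exact ⟨w, hw, w⁻¹ * g, QuotientGroup.eq.1 e, by simp⟩

end Covering

section Average

variable {Γ : Type*} [Group Γ] [Fintype Γ] [DecidableEq Γ]

/-- The average of the regular representation over a subgroup. -/
noncomputable def average (H : Subgroup Γ) [Fintype H] : Matrix Γ Γ ℝ :=
  (Fintype.card H : ℝ)⁻¹ • ∑ h : H, regRep (h : Γ)

variable (H G : Subgroup Γ) [Fintype H] [Fintype G]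

theorem average_mem_convAlg : average H ∈ convAlg Γ :=
  (convAlg Γ).smul_mem (sum_mem fun _ _ => regRep_mem_convAlg _) _

theorem average_apply_one (x : Γ) [Decidable (x ∈ H)] :
    average H x 1 = if x ∈ H then (Fintype.card H : ℝ)⁻¹ else 0 := by
  rw [average, Matrix.smul_apply, Matrix.sum_apply]
  simp only [regRep_apply, mul_one]
  split_ifs with hx
  · rw [sum_eq_single_of_mem ⟨x, hx⟩ (mem_univ _)]
    · simp
    · rintro ⟨h, hh⟩ _ hne
      rw [if_neg]
      rintro rfl
      exact hne rfl
  · rw [sum_eq_zero, smul_zero]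
    rintro ⟨h, hh⟩ _
    rw [if_neg]
    rintro rfl
    exact hx hh

theorem average_isHermitian : (average H).IsHermitian := by
  rw [Matrix.IsHermitian, Matrix.conjTranspose_eq_transpose_of_trivial, average,
    Matrix.transpose_smul, Matrix.transpose_sum]
  congr 1
  rw [← Equiv.sum_comp (Equiv.inv H)]
  simp [regRep_transpose]

variable {H G}

theorem regRep_mul_average {g : Γ} (hg : g ∈ H) : regRep g * average H = average H := by
  rw [average, Matrix.mul_smul, mul_sum]
  congr 1
  refine (sum_congr rfl fun h _ => ?_).trans
    (Equiv.sum_comp (Equiv.mulLeft (⟨g, hg⟩ : H)) fun h : H => regRep (h : Γ))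
  simp

theorem average_mul_regRep {g : Γ} (hg : g ∈ H) : average H * regRep g = average H := by
  rw [average, Matrix.smul_mul, sum_mul]
  congr 1
  refine (sum_congr rfl fun h _ => ?_).trans
    (Equiv.sum_comp (Equiv.mulRight (⟨g, hg⟩ : H)) fun h : H => regRep (h : Γ))
  simp

theorem average_mul_average (h : H ≤ G) : average H * average G = average G := by
  rw [average, Matrix.smul_mul, sum_mul, sum_congr rfl fun x _ => regRep_mul_average (h x.2),
    sum_const, card_univ, ← Nat.cast_smul_eq_nsmul ℝ, smul_smul, inv_mul_cancel₀, one_smul]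
  exact_mod_cast Fintype.card_ne_zero

theorem average_mul_average' (h : H ≤ G) : average G * average H = average G := by
  have := congrArg Matrix.transpose (average_mul_average h)
  have e1 := average_isHermitian H
  have e2 := average_isHermitian G
  rw [Matrix.IsHermitian, Matrix.conjTranspose_eq_transpose_of_trivial] at e1 e2
  rwa [Matrix.transpose_mul, e1, e2] at this

theorem one_sub_average_posSemidef : (1 - average H).PosSemidef := by
  have := Matrix.posSemidef_conjTranspose_mul_self (1 - average H)
  have e : IsIdempotentElem (average H) := average_mul_average le_rfl
  rwa [(Matrix.isHermitian_one.sub (average_isHermitian H)).eq, e.one_sub.eq] at this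

theorem average_commute_regRep [H.Normal] (g : Γ) : Commute (average H) (regRep g) := by
  refine Commute.smul_left ?_ _
  rw [Commute, SemiconjBy, sum_mul, mul_sum,
    ← Equiv.sum_comp (MulAut.conjNormal g : H ≃* H).toEquiv]
  refine sum_congr rfl fun h _ => ?_
  simp [← map_mul]

theorem average_commute_walk [H.Normal] (S : Finset Γ) : Commute (average H) (walk S) :=
  (Commute.sum_right _ _ _ fun s _ => average_commute_regRep s).smul_right _

theorem walk_mul_average {S : Finset Γ} (hS : S.Nonempty) (h : ∀ s ∈ S, s ∈ G) :
    walk S * average G = average G := by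
  rw [walk, Matrix.smul_mul, sum_mul, sum_congr rfl fun x hx => regRep_mul_average (h x hx),
    sum_const, ← Nat.cast_smul_eq_nsmul ℝ, smul_smul, inv_mul_cancel₀, one_smul]
  exact_mod_cast hS.card_pos.ne'

theorem average_mul_walk {S : Finset Γ} (hS : S.Nonempty) (h : ∀ s ∈ S, s ∈ G) :
    average G * walk S = average G := by
  rw [walk, Matrix.mul_smul, mul_sum, sum_congr rfl fun x hx => average_mul_regRep (h x hx),
    sum_const, ← Nat.cast_smul_eq_nsmul ℝ, smul_smul, inv_mul_cancel₀, one_smul]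
  exact_mod_cast hS.card_pos.ne'

end Average

section Mixing

open scoped Pointwise

variable {Γ : Type*} [Group Γ] [Fintype Γ]

omit [Group Γ] in
theorem dotProduct_self_mulVec {M : Matrix Γ Γ ℝ} (hM : M.IsHermitian) (f : Γ → ℝ) :
    (M *ᵥ f) ⬝ᵥ (M *ᵥ f) = f ⬝ᵥ (M * M) *ᵥ f := by
  have e : Mᵀ = M := by rw [← Matrix.conjTranspose_eq_transpose_of_trivial]; exact hM
  rw [← Matrix.mulVec_mulVec, Matrix.dotProduct_mulVec f, ← Matrix.mulVec_transpose, e]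

theorem sum_sq_apply_one {M : Matrix Γ Γ ℝ} (hM : M.IsHermitian) :
    ∑ x, M x 1 ^ 2 = (M * M) 1 1 := by
  rw [Matrix.mul_apply]
  refine sum_congr rfl fun x _ => ?_
  have : M 1 x = M x 1 := by simpa using hM.apply x 1
  rw [this, pow_two]

theorem sum_abs_le_sqrt (G : Subgroup Γ) [Fintype G] (f : Γ → ℝ) :
    ∑ g : G, |f g| ≤ √(Fintype.card G * ∑ x, f x ^ 2) := by
  refine Real.le_sqrt_of_sq_le ?_
  have h := sq_sum_le_card_mul_sum_sq (s := (univ : Finset G)) (f := fun g => |f g|)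
  rw [card_univ] at h
  refine h.trans ?_
  gcongr
  simp only [sq_abs]
  have := sum_le_sum_of_subset_of_nonneg
    (subset_univ ((univ : Finset G).map ⟨_, Subtype.val_injective⟩))
    (f := fun x => f x ^ 2) (fun _ _ _ => by positivity)
  simpa using this

variable [DecidableEq Γ]

variable {H : Subgroup Γ} [Fintype H] {S : Finset Γ} {G : Subgroup Γ} [Fintype G]

theorem dotProduct_self_le_energy [H.Normal] (h1 : 1 ∈ S) (hS : ∀ s ∈ S, s⁻¹ ∈ S)
    (hG : G = Subgroup.closure (S : Set Γ)) {f : Γ → ℝ} (hH : average H *ᵥ f = f)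
    (hf : average G *ᵥ f = 0) :
    f ⬝ᵥ f ≤ ((H.index : ℝ) * #S) ^ 2 * energy S f := by
  have hc : (0 : ℝ) < Fintype.card G := by exact_mod_cast Fintype.card_pos
  have hd : ∀ g : G, disp f g ^ 2 ≤ (H.index : ℝ) ^ 2 * (2 * (#S : ℝ) ^ 2 * energy S f) := by
    intro g
    obtain ⟨w, hw, h, hh, e⟩ := exists_mem_pow_index_mul (H := H) (g := (g : Γ)) h1 hS
      (by rw [← hG]; exact g.2)
    have h0 : disp f h = 0 := by
      have : regRep h *ᵥ f = f := by
        rw [← hH, Matrix.mulVec_mulVec, regRep_mul_average hh]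
      have e := dotProduct_regRep f h
      rw [this] at e
      exact pow_eq_zero_iff two_ne_zero |>.1 (by linarith)
    refine le_trans ?_ (disp_le_energy h1 f hw)
    have := disp_mul_le f w h
    rw [h0, add_zero] at this
    rw [e]
    exact pow_le_pow_left₀ (disp_nonneg _ _) this 2
  have hs : ∑ g : G, (f ⬝ᵥ f - disp f g ^ 2 / 2) = 0 := by
    have e : f ⬝ᵥ average G *ᵥ f = 0 := by rw [hf, dotProduct_zero]
    rw [average, Matrix.smul_mulVec, dotProduct_smul, Matrix.sum_mulVec, dotProduct_sum,
      smul_eq_mul, mul_eq_zero] at e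
    simpa [dotProduct_regRep, hc.ne'] using e
  rw [sum_sub_distrib, sum_const, card_univ, nsmul_eq_mul] at hs
  have : ∑ g : G, disp f g ^ 2 / 2
      ≤ ∑ g : G, (H.index : ℝ) ^ 2 * (2 * (#S : ℝ) ^ 2 * energy S f) / 2 :=
    sum_le_sum fun g _ => div_le_div_of_nonneg_right (hd g) (by norm_num)
  rw [sum_const, card_univ, nsmul_eq_mul] at this
  refine le_of_mul_le_mul_left ?_ hc
  linarith

theorem walk_pow_decay [H.Normal] (h1 : 1 ∈ S) (hS : ∀ s ∈ S, s⁻¹ ∈ S)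
    (hG : G = Subgroup.closure (S : Set Γ)) {f : Γ → ℝ} (hH : average H *ᵥ f = f)
    (hf : average G *ᵥ f = 0) (N : ℕ) :
    (walk S ^ N *ᵥ f) ⬝ᵥ (walk S ^ N *ᵥ f)
      ≤ (1 - 1 / ((H.index : ℝ) * #S) ^ 2) ^ N * (f ⬝ᵥ f) := by
  have hSG : ∀ s ∈ S, s ∈ G := fun s hs => hG ▸ Subgroup.subset_closure hs
  have hc : (1 : ℝ) ≤ ((H.index : ℝ) * #S) ^ 2 := by
    have h1 : 1 ≤ H.index := Nat.one_le_iff_ne_zero.2 H.index_ne_zero_of_finite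
    have h2 : 1 ≤ #S := card_pos.2 ⟨1, ‹_›⟩
    exact one_le_pow₀ (by exact_mod_cast Nat.mul_le_mul h1 h2)
  induction N with
  | zero => simp
  | succ N ih =>
    set v := walk S ^ N *ᵥ f with hv
    have hv1 : average H *ᵥ v = v := by
      rw [hv, Matrix.mulVec_mulVec, ((average_commute_walk S).pow_right N).eq,
        ← Matrix.mulVec_mulVec, hH]
    have hv2 : average G *ᵥ v = 0 := by
      have : average G * walk S ^ N = average G := by
        clear_value v
        clear ih hv hv1
        induction N with
        | zero => simp
        | succ N ih => rw [pow_succ, ← mul_assoc, ih, average_mul_walk ⟨1, h1⟩ hSG]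
      rw [hv, Matrix.mulVec_mulVec, this, hf]
    have hE := dotProduct_self_le_energy h1 hS hG hv1 hv2
    have h2 : (walk S *ᵥ v) ⬝ᵥ (walk S *ᵥ v) = v ⬝ᵥ v - energy S v := by
      rw [dotProduct_self_mulVec (walk_isHermitian hS), energy]; ring
    rw [pow_succ', ← Matrix.mulVec_mulVec, h2, pow_succ', mul_assoc]
    calc v ⬝ᵥ v - energy S v ≤ (1 - 1 / ((H.index : ℝ) * #S) ^ 2) * (v ⬝ᵥ v) := by
          have : (v ⬝ᵥ v) / ((H.index : ℝ) * #S) ^ 2 ≤ energy S v := by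
            rw [div_le_iff₀ (by linarith)]; linarith
          rw [sub_mul, one_mul, div_mul_eq_mul_div, one_mul]
          linarith
      _ ≤ _ := by
          refine mul_le_mul_of_nonneg_left ih ?_
          rw [sub_nonneg, div_le_one (by linarith)]
          exact hc

theorem sum_sq_one_sub_average_mul_walk_pow_le [H.Normal] (hS : ∀ s ∈ S, s⁻¹ ∈ S)
    {K : Matrix Γ Γ ℝ} (hK : K.PosSemidef) (hKc : K ∈ convAlg Γ) (hKH : K * average H = average H)
    (hKH' : average H * K = average H) (hKS : (K - walk S * walk S).PosSemidef) {N : ℕ}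
    (hN : N ≠ 0) :
    ∑ x, ((walk S ^ N * (1 - average H)) x 1) ^ 2
      ≤ (K ^ N) 1 1 - (Fintype.card H : ℝ)⁻¹ := by
  set Q : Matrix Γ Γ ℝ := 1 - average H with hQ
  have hid : IsIdempotentElem Q :=
    (show IsIdempotentElem (average H) from average_mul_average le_rfl).one_sub
  have hQpow : Q ^ N = Q := hid.pow_eq hN
  have hQh : Q.IsHermitian := Matrix.isHermitian_one.sub (average_isHermitian H)
  have hQc : Q ∈ convAlg Γ := sub_mem (one_mem _) (average_mem_convAlg H)
  have hQw : Commute Q (walk S) := (Commute.one_left _).sub_left (average_commute_walk S)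
  have hQK : Commute K Q :=
    (Commute.one_right K).sub_right (hKH.trans hKH'.symm)
  have hw := walk_isHermitian hS
  have hWW : (walk S * walk S).PosSemidef := by
    have := Matrix.posSemidef_conjTranspose_mul_self (walk S)
    rwa [hw.eq] at this
  have hQQ : Commute (walk S * walk S) Q := (hQw.mul_right hQw).symm
  have htr := Matrix.PosSemidef.trace_pow_le
    (hWW.mul_of_commute (one_sub_average_posSemidef (H := H)) hQQ)
    (hK.mul_of_commute (one_sub_average_posSemidef (H := H)) hQK)
    (by
      rw [← sub_mul]
      exact hKS.mul_of_commute one_sub_average_posSemidef (hQK.sub_left hQQ)) N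
  rw [hQQ.mul_pow, hQK.mul_pow, hQpow] at htr
  rw [convAlg_trace (mul_mem (pow_mem (mul_mem (walk_mem_convAlg S) (walk_mem_convAlg S)) N) hQc),
    convAlg_trace (mul_mem (pow_mem hKc N) hQc)] at htr
  have h1 := le_of_mul_le_mul_left htr (by exact_mod_cast Fintype.card_pos)
  have hher : (walk S ^ N * Q).IsHermitian :=
    ((hw.pow N).commute_iff hQh).1 (hQw.symm.pow_left N)
  have e1 : (walk S ^ N * Q) * (walk S ^ N * Q) = (walk S * walk S) ^ N * Q := by
    rw [(Commute.refl (walk S)).mul_pow, mul_assoc, ← mul_assoc Q, (hQw.pow_right N).eq,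
      mul_assoc, mul_assoc, hid.eq]
  have hKN : K ^ N * average H = average H := by
    clear hN hQpow htr h1 hher e1
    induction N with
    | zero => simp
    | succ N ih => rw [pow_succ, mul_assoc, hKH, ih]
  classical
  have e2 : (K ^ N * Q) 1 1 = (K ^ N) 1 1 - (Fintype.card H : ℝ)⁻¹ := by
    rw [hQ, mul_sub, mul_one, hKN, Matrix.sub_apply, average_apply_one, if_pos (one_mem _)]
  rw [sum_sq_apply_one hher, e1, ← e2]
  exact h1

theorem sum_abs_walk_pow_sub_le [H.Normal] (h1 : 1 ∈ S) (hS : ∀ s ∈ S, s⁻¹ ∈ S)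
    (hG : G = Subgroup.closure (S : Set Γ)) (hHG : H ≤ G)
    {K : Matrix Γ Γ ℝ} (hK : K.PosSemidef) (hKc : K ∈ convAlg Γ) (hKH : K * average H = average H)
    (hKH' : average H * K = average H) (hKS : (K - walk S * walk S).PosSemidef) {N : ℕ}
    (hN : N ≠ 0) :
    ∑ g : G, |(walk S ^ N) g 1 - (Fintype.card G : ℝ)⁻¹|
      ≤ √(Fintype.card Γ * (K ^ N) 1 1 - H.index)
        + √(H.index * (1 - 1 / ((H.index : ℝ) * #S) ^ 2) ^ N) := by
  classical
  have hSG : ∀ s ∈ S, s ∈ G := fun s hs => hG ▸ Subgroup.subset_closure hs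
  have hH0 : (0 : ℝ) < Fintype.card H := by exact_mod_cast Fintype.card_pos
  have hidx : (Fintype.card Γ : ℝ) = H.index * Fintype.card H := by
    have := H.index_mul_card
    rw [Nat.card_eq_fintype_card, Nat.card_eq_fintype_card] at this
    exact_mod_cast this.symm
  have hGΓ : (Fintype.card G : ℝ) ≤ Fintype.card Γ := by
    exact_mod_cast Fintype.card_le_of_injective _ (Subtype.val_injective : Function.Injective
      (Subtype.val : G → Γ))
  have hwG : ∀ N : ℕ, walk S ^ N * average G = average G := by
    intro N
    induction N with
    | zero => simp
    | succ N ih => rw [pow_succ, mul_assoc, walk_mul_average ⟨1, h1⟩ hSG, ih]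
  set v : Γ → ℝ := fun x => (average H - average G) x 1 with hv
  have hmv : ∀ M : Matrix Γ Γ ℝ, M *ᵥ v = fun x => (M * (average H - average G)) x 1 := by
    intro M
    ext x
    rw [Matrix.mul_apply]
    rfl
  have hD : (average H - average G) * (average H - average G) = average H - average G := by
    rw [mul_sub, sub_mul, sub_mul, average_mul_average le_rfl, average_mul_average le_rfl,
      average_mul_average hHG, average_mul_average' hHG]
    abel
  have hvv : v ⬝ᵥ v ≤ (Fintype.card H : ℝ)⁻¹ := by
    have h := sum_sq_apply_one ((average_isHermitian H).sub (average_isHermitian G))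
    rw [hD, Matrix.sub_apply, average_apply_one, average_apply_one, if_pos (one_mem _),
      if_pos (one_mem _)] at h
    have : v ⬝ᵥ v = ∑ x, (average H - average G) x 1 ^ 2 :=
      sum_congr rfl fun x _ => (pow_two _).symm
    rw [this, h, sub_le_self_iff]
    positivity
  have hdec := walk_pow_decay (f := v) h1 hS hG
    (by rw [hmv, mul_sub, average_mul_average le_rfl, average_mul_average hHG])
    (by
      rw [hmv, mul_sub, average_mul_average le_rfl, average_mul_average' hHG, sub_self]
      rfl) N
  have hρ : 0 ≤ 1 - 1 / ((H.index : ℝ) * #S) ^ 2 := by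
    have h1 : 1 ≤ H.index := Nat.one_le_iff_ne_zero.2 H.index_ne_zero_of_finite
    have h2 : 1 ≤ #S := card_pos.2 ⟨1, ‹_›⟩
    have hc : (1 : ℝ) ≤ ((H.index : ℝ) * #S) ^ 2 :=
      one_le_pow₀ (by exact_mod_cast Nat.mul_le_mul h1 h2)
    rw [sub_nonneg, div_le_one (by linarith)]
    exact hc
  calc ∑ g : G, |(walk S ^ N) g 1 - (Fintype.card G : ℝ)⁻¹|
      ≤ ∑ g : G, |(walk S ^ N * (1 - average H)) g 1| + ∑ g : G, |(walk S ^ N *ᵥ v) g| := by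
        rw [← sum_add_distrib]
        refine sum_le_sum fun g _ => ?_
        refine le_trans (le_of_eq ?_) (abs_add_le _ _)
        congr 1
        have e : (walk S ^ N *ᵥ v) g = (walk S ^ N * (average H - average G)) g 1 := by rw [hmv]
        rw [e, mul_sub, mul_sub, hwG, mul_one, Matrix.sub_apply, Matrix.sub_apply,
          average_apply_one G, if_pos g.2]
        ring
    _ ≤ _ := by
        refine add_le_add
          ((sum_abs_le_sqrt G fun x => (walk S ^ N * (1 - average H)) x 1).trans ?_)
          ((sum_abs_le_sqrt G _).trans ?_)
        · refine Real.sqrt_le_sqrt ?_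
          have h := sum_sq_one_sub_average_mul_walk_pow_le hS hK hKc hKH hKH' hKS hN
          have hnn : 0 ≤ ∑ x, ((walk S ^ N * (1 - average H)) x 1) ^ 2 :=
            sum_nonneg fun _ _ => sq_nonneg _
          calc _ ≤ (Fintype.card Γ : ℝ) * ((K ^ N) 1 1 - (Fintype.card H : ℝ)⁻¹) := by gcongr
            _ = _ := by
              rw [mul_sub, hidx]
              field_simp
        · refine Real.sqrt_le_sqrt ?_
          have : ∑ x, (walk S ^ N *ᵥ v) x ^ 2 = (walk S ^ N *ᵥ v) ⬝ᵥ (walk S ^ N *ᵥ v) :=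
            sum_congr rfl fun x _ => pow_two _
          rw [this]
          calc _ ≤ (Fintype.card Γ : ℝ) * ((1 - 1 / ((H.index : ℝ) * #S) ^ 2) ^ N
                  * (Fintype.card H : ℝ)⁻¹) := by
                refine mul_le_mul hGΓ (hdec.trans ?_) ?_ (by positivity)
                · gcongr
                · rw [← this]
                  exact sum_nonneg fun _ _ => sq_nonneg _
            _ = _ := by rw [hidx]; field_simp

end Mixing

section PermMixing

open Equiv
open scoped Pointwise

variable {m : ℕ} {B : Type*} [CommGroup B]

theorem sign_cyc {α : Type*} [DecidableEq α] [Fintype α] {i j k : α} (h1 : i ≠ j) (h2 : j ≠ k) :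
    Perm.sign (cyc i j k) = 1 := by
  simp [cyc, Perm.sign_swap h1, Perm.sign_swap h2]

/-- The sign of the first component, together with the second component. -/
def signSnd (m : ℕ) (B : Type*) [CommGroup B] : Perm (Fin m) × B →* ℤˣ × B :=
  (Perm.sign : Perm (Fin m) →* ℤˣ).prodMap (MonoidHom.id B)

theorem cyc_mem_ker_signSnd {i j k : Fin m} (h1 : i ≠ j) (h2 : j ≠ k) :
    (cyc i j k, (1 : B)) ∈ (signSnd m B).ker := by
  rw [MonoidHom.mem_ker]
  simp [signSnd, sign_cyc h1 h2]

theorem index_ker_signSnd [Fintype B] (hm : 2 ≤ m) :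
    (signSnd m B).ker.index = 2 * Fintype.card B := by
  have : Nontrivial (Fin m) := Fin.nontrivial_iff_two_le.2 hm
  have hs : Function.Surjective (signSnd m B) :=
    (Perm.sign_surjective (Fin m)).prodMap Function.surjective_id
  rw [Subgroup.index_ker, MonoidHom.range_eq_top.2 hs]
  simp

theorem ker_signSnd_le {G : Subgroup (Perm (Fin m) × B)}
    (h : ∀ i j k : Fin m, i ≠ j → i ≠ k → j ≠ k → (cyc i j k, (1 : B)) ∈ G) :
    (signSnd m B).ker ≤ G := by
  rintro ⟨σ, b⟩ hσ
  obtain ⟨h1, rfl⟩ : Perm.sign σ = 1 ∧ b = 1 := by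
    simpa [MonoidHom.mem_ker, signSnd, Prod.ext_iff] using hσ
  have h2 : σ ∈ alternatingGroup (Fin m) := h1
  have h3 : alternatingGroup (Fin m) ≤ G.comap (MonoidHom.inl (Perm (Fin m)) B) := by
    rw [← Perm.closure_three_cycles_eq_alternating, Subgroup.closure_le]
    intro τ hτ
    have hτ' : τ.IsThreeCycle := hτ
    obtain ⟨a, ha⟩ := hτ'.isCycle.nonempty_support
    have e : τ = cyc a (τ a) (τ (τ a)) := hτ'.eq_swap_mul_swap_iff_mem_support.2 ha
    have hn := hτ'.nodup_iff_mem_support.2 ha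
    simp only [List.nodup_cons, List.mem_cons, List.not_mem_nil, or_false, not_or] at hn
    rw [e]
    exact h _ _ _ hn.1.1 hn.1.2 hn.2.1
  exact h3 h2

variable [Fintype B] [DecidableEq B]

theorem levelProd_mul_average {H : Subgroup (Perm (Fin m) × B)} [Fintype H] (ε : ℝ)
    (h : ∀ i j k : Fin m, i ≠ j → i ≠ k → j ≠ k → (cyc i j k, (1 : B)) ∈ H) {q : ℕ} (hq : q ≤ m) :
    levelProd m B ε q * average H = average H := by
  induction q with
  | zero => simp [levelProd]
  | succ q ih =>
    have : level B ε ⟨q, hq⟩ * average H = average H := by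
      rw [level, sub_mul, one_mul, Matrix.smul_mul, sum_mul, sum_eq_zero, smul_zero, sub_zero]
      intro p hp
      simp only [mem_offDiag, mem_Iio] at hp
      rw [sub_mul, one_mul, regRep_mul_average (h _ _ _ hp.2.2 hp.1.ne hp.2.1.ne), sub_self]
    rw [levelProd_succ ε hq, mul_assoc, this, ih (by omega)]

theorem sum_abs_walk_pow_sub_perm_le (hm : 2 ≤ m) {S : Finset (Perm (Fin m) × B)} (h1 : 1 ∈ S)
    (hS : ∀ s ∈ S, s⁻¹ ∈ S) {G : Subgroup (Perm (Fin m) × B)} [Fintype G]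
    (hG : G = Subgroup.closure (S : Set (Perm (Fin m) × B))) {L : ℕ} (hL : L ≠ 0)
    (h : ∀ i j k : Fin m, i ≠ j → i ≠ k → j ≠ k →
      (cyc i j k, (1 : B)) ∈ (S : Set (Perm (Fin m) × B)) ^ L) {N : ℕ} (hN : N ≠ 0) :
    ∑ g : G, |(walk S ^ N) g 1 - (Fintype.card G : ℝ)⁻¹|
      ≤ √(2 * Fintype.card B *
          (Real.exp ((m : ℝ) ^ 2 * Real.exp (-(1 / ((#S : ℝ) ^ 2 * L ^ 2 * m) * N))) - 1))
        + √(2 * Fintype.card B * (1 - 1 / (2 * Fintype.card B * #S : ℝ) ^ 2) ^ N) := by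
  classical
  set H : Subgroup (Perm (Fin m) × B) := (signSnd m B).ker
  have hidx : (H.index : ℝ) = 2 * Fintype.card B := by
    rw [index_ker_signSnd hm]; push_cast; rfl
  have hHG : H ≤ G := ker_signSnd_le fun i j k hij hik hjk => by
    rw [hG]
    exact (mem_closure_iff_exists_pow hS).2 ⟨L, h i j k hij hik hjk⟩
  set ε : ℝ := 1 / ((#S : ℝ) ^ 2 * L ^ 2 * m) with hεdef
  have hs1 : (1 : ℝ) ≤ (#S : ℝ) := by exact_mod_cast card_pos.2 ⟨1, h1⟩
  have hL1 : (1 : ℝ) ≤ L := by exact_mod_cast Nat.one_le_iff_ne_zero.2 hL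
  have hm2 : (2 : ℝ) ≤ m := by exact_mod_cast hm
  have hden : (2 : ℝ) ≤ (#S : ℝ) ^ 2 * L ^ 2 * m := by
    have h1 : (1 : ℝ) ≤ (#S : ℝ) ^ 2 * L ^ 2 := one_le_mul_of_one_le_of_one_le
      (one_le_pow₀ hs1) (one_le_pow₀ hL1)
    nlinarith
  have hε : 0 ≤ ε := by positivity
  have hε' : ε ≤ 1 / 2 := one_div_le_one_div_of_le (by norm_num) hden
  set K := levelProd m B ε m
  have hK : K.PosSemidef := levelProd_posSemidef hε hε' le_rfl
  have hKH : K * average H = average H :=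
    levelProd_mul_average ε (fun i j k hij _ hjk => cyc_mem_ker_signSnd hij hjk) le_rfl
  have hKH' : average H * K = average H := by
    have := congrArg Matrix.conjTranspose hKH
    rwa [Matrix.conjTranspose_mul, hK.1.eq, (average_isHermitian H).eq] at this
  have hKS : (K - walk S * walk S).PosSemidef := by
    have hw := walk_isHermitian hS
    refine .of_dotProduct_mulVec_nonneg (hK.1.sub ((hw.commute_iff hw).1 (Commute.refl _)))
      fun f => ?_
    have hE := energy_nonneg h1 f
    have h2 := one_sub_levelProd_form_le hε hε' f (q := m)
      (D := (L : ℝ) ^ 2 * (2 * (#S : ℝ) ^ 2 * energy S f)) (by positivity)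
      (fun i j k hij hik hjk => disp_le_energy h1 f (h i j k hij hik hjk)) le_rfl
    have h3 : (m : ℝ) * (ε * ((L : ℝ) ^ 2 * (2 * (#S : ℝ) ^ 2 * energy S f) / 2))
        = energy S f := by
      rw [hεdef]; field_simp
    rw [h3, energy, Matrix.sub_mulVec, Matrix.one_mulVec, dotProduct_sub] at h2
    rw [star_trivial, Matrix.sub_mulVec, dotProduct_sub]
    linarith
  have main := sum_abs_walk_pow_sub_le h1 hS hG hHG hK (levelProd_mem_convAlg ε m) hKH hKH' hKS hN
  rw [hidx] at main
  refine main.trans (add_le_add (Real.sqrt_le_sqrt ?_) le_rfl)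
  have h2 := levelProd_pow_apply_le (B := B) hε hε' N hm le_rfl
  rw [Fintype.card_prod, Fintype.card_perm, Fintype.card_fin]
  push_cast
  have hB : (0 : ℝ) ≤ Fintype.card B := by positivity
  nlinarith [mul_le_mul_of_nonneg_left h2 hB]

end PermMixing

section ThreeCycles

open Equiv
open scoped Pointwise

variable {V B : Type*} [DecidableEq V] [Group B]

theorem cyc_mem_of_cyc_mem {X : Set (Perm V × B)} (h1 : (1 : Perm V × B) ∈ X)
    (hinv : ∀ x ∈ X, x⁻¹ ∈ X) {p : V → Prop} {a b : V} (hab : a ≠ b)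
    (h : ∀ z, p z → z ≠ a → z ≠ b → (cyc a b z, (1 : B)) ∈ X) {x y z : V} (hx : p x)
    (hy : p y) (hz : p z) (hxy : x ≠ y) (hxz : x ≠ z) (hyz : y ≠ z) :
    (cyc x y z, (1 : B)) ∈ X ^ 5 := by
  have mono : ∀ {k : ℕ} {u : Perm V × B}, k ≤ 5 → u ∈ X ^ k → u ∈ X ^ 5 := fun hk hu =>
    Set.pow_subset_pow_right h1 hk hu
  have conj : ∀ {k : ℕ} {u v w : V} {g : Perm V}, (cyc u v w, (1 : B)) ∈ X ^ k →
      (g, (1 : B)) ∈ X → (cyc (g u) (g v) (g w), (1 : B)) ∈ X ^ (k + 2) := by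
    intro k u v w g hu hg
    have : (cyc (g u) (g v) (g w), (1 : B)) = (g, 1) * (cyc u v w, 1) * (g, 1)⁻¹ := by
      rw [← cyc_conj]; simp
    rw [this, show k + 2 = 1 + k + 1 by ring, pow_succ, pow_add, pow_one]
    exact Set.mul_mem_mul (Set.mul_mem_mul hg hu) (hinv _ hg)
  have hinv' : ∀ {u v w : V}, u ≠ w → v ≠ w → (cyc u v w, (1 : B)) ∈ X →
      (cyc v u w, (1 : B)) ∈ X := by
    intro u v w h1 h2 hu
    have := hinv _ hu
    rwa [Prod.inv_mk, cyc_inv h1 h2, inv_one] at this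
  have hbxz : ∀ {x z}, p x → p z → x ≠ a → x ≠ b → z ≠ a → z ≠ b → x ≠ z →
      (cyc b x z, (1 : B)) ∈ X ^ 3 := by
    intro x z hx hz hxa hxb hza hzb hxz
    have := conj (k := 1) (by rw [pow_one]; exact h z hz hza hzb) (h x hx hxa hxb)
    rwa [cyc_apply_left hab hxa.symm, cyc_apply_mid hxa.symm hxb.symm,
      cyc_apply_of_ne hza hzb hxz.symm] at this
  have hA : ∀ {y z}, p y → p z → y ≠ a → z ≠ a → y ≠ z → (cyc a y z, (1 : B)) ∈ X ^ 5 := by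
    intro y z hy hz hya hza hyz
    by_cases hyb : y = b
    · subst hyb
      exact mono (k := 1) (by norm_num) (by rw [pow_one]; exact h z hz hza hyz.symm)
    by_cases hzb : z = b
    · subst hzb
      rw [cyc_rotate hab hya.symm, cyc_rotate hya hyz]
      exact mono (k := 1) (by norm_num)
        (by rw [pow_one]; exact hinv' hya.symm hyz.symm (h y hy hya hyz))
    have := conj (k := 1) (by rw [pow_one]; exact h y hy hya hyb)
      (hinv' hza.symm (Ne.symm hzb) (h z hz hza hzb))
    rw [cyc_apply_mid (Ne.symm hzb) hza.symm, cyc_apply_left hab.symm (Ne.symm hzb),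
      cyc_apply_of_ne hyb hya hyz] at this
    rw [cyc_rotate hza.symm hya.symm, cyc_rotate hya hyz]
    exact mono (by norm_num) this
  have hB : ∀ {y z}, p y → p z → y ≠ b → z ≠ b → y ≠ z → (cyc b y z, (1 : B)) ∈ X ^ 5 := by
    intro y z hy hz hyb hzb hyz
    by_cases hya : y = a
    · subst hya
      exact mono (k := 1) (by norm_num)
        (by rw [pow_one]; exact hinv' hyz hzb.symm (h z hz hyz.symm hzb))
    by_cases hza : z = a
    · subst hza
      rw [cyc_rotate hab.symm hyb.symm, cyc_rotate hyb hyz]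
      exact mono (k := 1) (by norm_num) (by rw [pow_one]; exact h y hy hyz hyb)
    exact mono (by norm_num) (hbxz hy hz hya hyb hza hzb hyz)
  rcases eq_or_ne x a with rfl | hxa
  · exact hA hy hz hxy.symm hxz.symm hyz
  rcases eq_or_ne x b with rfl | hxb
  · exact hB hy hz hxy.symm hxz.symm hyz
  rcases eq_or_ne y a with rfl | hya
  · rw [cyc_rotate hxz hxy]
    exact hA hz hx hyz.symm hxy hxz.symm
  rcases eq_or_ne y b with rfl | hyb
  · rw [cyc_rotate hxz hxy]
    exact hB hz hx hyz.symm hxy hxz.symm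
  rcases eq_or_ne z a with rfl | hza
  · rw [cyc_rotate hxz hxy, cyc_rotate hxy.symm hyz]
    exact hA hx hy hxz hyz hxy
  rcases eq_or_ne z b with rfl | hzb
  · rw [cyc_rotate hxz hxy, cyc_rotate hxy.symm hyz]
    exact hB hx hy hxz hyz hxy
  have := conj (hbxz hy hz hya hyb hza hzb hyz) (h x hx hxa hxb)
  rwa [cyc_apply_mid hxa.symm hxb.symm, cyc_apply_of_ne hya hyb hxy.symm,
    cyc_apply_of_ne hza hzb hxz.symm] at this

end ThreeCycles

section Paths

open Equiv
open scoped Pointwise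

/-- The permutation obtained by moving the empty square from `v` through the cells of a list. -/
def pathPerm {V : Type*} [DecidableEq V] : V → List V → Perm V
  | _, [] => 1
  | v, w :: l => pathPerm w l * swap v w

variable {V W : Type*} [DecidableEq V] [DecidableEq W] {f : W → V}

theorem pathPerm_map (hf : f.Injective) (v : W) (l : List W) (x : W) :
    pathPerm (f v) (l.map f) (f x) = f (pathPerm v l x) := by
  induction l generalizing v x with
  | nil => rfl
  | cons w l ih =>
    rw [List.map_cons, pathPerm, pathPerm, Perm.mul_apply, Perm.mul_apply, hf.swap_apply, ih]

omit [DecidableEq W] in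
theorem pathPerm_map_of_notMem (v : W) (l : List W) {y : V} (hy : ∀ x, y ≠ f x) :
    pathPerm (f v) (l.map f) y = y := by
  induction l generalizing v with
  | nil => rfl
  | cons w l ih =>
    rw [List.map_cons, pathPerm, Perm.mul_apply, swap_apply_of_ne_of_ne (hy v) (hy w), ih]

theorem pathPerm_map_eq_cyc (hf : f.Injective) {v : W} {l : List W} {i j k : W}
    (h : ∀ x, pathPerm v l x = cyc i j k x) :
    pathPerm (f v) (l.map f) = cyc (f i) (f j) (f k) := by
  ext y
  by_cases hy : ∃ x, y = f x
  · obtain ⟨x, rfl⟩ := hy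
    rw [pathPerm_map hf, h, cyc, cyc, Perm.mul_apply, Perm.mul_apply, hf.swap_apply,
      hf.swap_apply]
  · push Not at hy
    rw [pathPerm_map_of_notMem v l hy, cyc_apply_of_ne (hy i) (hy j) (hy k)]

/-- The effect of moving the empty square by `d`, in coordinates centered at the empty square. -/
def shiftStep {V : Type*} [DecidableEq V] [AddCommGroup V] (d : V) : Perm V × Multiplicative V :=
  (Equiv.addRight (-d) * swap 0 d, Multiplicative.ofAdd d)

theorem mem_pow_of_path [AddCommGroup V] {D : Set V} (l : List V) :
    ∀ (v : V), List.IsChain (fun v w => w - v ∈ D) (v :: l) → ∀ w, (v :: l).getLast? = some w →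
      ∃ g ∈ (shiftStep '' D) ^ l.length, ∀ ρ : Perm V,
        g * (Equiv.addRight (-v) * ρ, Multiplicative.ofAdd v)
          = (Equiv.addRight (-w) * (pathPerm v l * ρ), Multiplicative.ofAdd w) := by
  induction l with
  | nil =>
    intro v _ w hw
    refine ⟨1, by simp, fun ρ => ?_⟩
    obtain rfl : v = w := by simpa using hw
    simp [pathPerm]
  | cons u l ih =>
    intro v hv w hw
    rw [List.isChain_cons_cons] at hv
    obtain ⟨g, hg, h⟩ := ih u hv.2 w (by simpa using hw)
    refine ⟨g * shiftStep (u - v), ?_, fun ρ => ?_⟩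
    · rw [List.length_cons, pow_succ]
      exact Set.mul_mem_mul hg (Set.mem_image_of_mem _ hv.1)
    · rw [pathPerm, mul_assoc (pathPerm u l), ← h (swap v u * ρ), mul_assoc]
      congr 1
      rw [shiftStep, Prod.mk_mul_mk, ← ofAdd_add, sub_add_cancel]
      congr 1
      have e := swap_apply_apply (Equiv.addRight (-v)) v u
      have e1 : (Equiv.addRight (-v)) v = 0 := by simp
      have e2 : (Equiv.addRight (-v)) u = u - v := by simp [sub_eq_add_neg]
      rw [e1, e2] at e
      have e3 : (Equiv.addRight (-u) : Perm V) =
          Equiv.addRight (-(u - v)) * Equiv.addRight (-v) := by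
        ext x
        simp
        abel
      rw [e, e3]
      group

theorem mem_pow_of_path_zero [AddCommGroup V] {D : Set V} {l : List V}
    (hl : List.IsChain (fun v w => w - v ∈ D) (0 :: l)) {w : V}
    (hw : (0 :: l).getLast? = some w) :
    (Equiv.addRight (-w) * pathPerm 0 l, Multiplicative.ofAdd w) ∈ (shiftStep '' D) ^ l.length := by
  obtain ⟨g, hg, h⟩ := mem_pow_of_path l 0 hl w hw
  have := h 1
  rw [mul_one, mul_one, neg_zero, Equiv.addRight_zero] at this
  rw [← this]
  convert hg using 1
  exact mul_one g

end Paths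

section Board

open Equiv
open scoped Pointwise

theorem shiftStep_zero {V : Type*} [DecidableEq V] [AddCommGroup V] : shiftStep (0 : V) = 1 := by
  simp [shiftStep]
  rfl

theorem shiftStep_neg {V : Type*} [DecidableEq V] [AddCommGroup V] (d : V) :
    shiftStep (-d) = (shiftStep d)⁻¹ := by
  have e := swap_apply_apply (Equiv.addRight (-d)) 0 d
  have e1 : (Equiv.addRight (-d)) 0 = -d := by simp
  have e2 : (Equiv.addRight (-d)) d = 0 := by simp
  rw [e1, e2, swap_comm] at e
  have e3 : (Equiv.addRight (- -d) : Perm V) = (Equiv.addRight (-d))⁻¹ := by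
    rw [eq_inv_iff_mul_eq_one]
    ext x
    simp
  rw [shiftStep, shiftStep, Prod.inv_mk, ofAdd_neg, e, e3, mul_assoc, inv_mul_cancel_left,
    mul_inv_rev, swap_inv]

/-- Adjacency of cells of a three by three board. -/
abbrev windowAdj (v w : Fin 3 × Fin 3) : Prop :=
  (v.1 = w.1 ∧ ((v.2 : ℕ) + 1 = w.2 ∨ (w.2 : ℕ) + 1 = v.2)) ∨
    (v.2 = w.2 ∧ ((v.1 : ℕ) + 1 = w.1 ∨ (w.1 : ℕ) + 1 = v.1))

/-- The inclusion of the three by three board. -/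
def window (n : ℕ) (v : Fin 3 × Fin 3) : ZMod n × ZMod n :=
  (((v.1 : ℕ) : ZMod n), ((v.2 : ℕ) : ZMod n))

variable {n : ℕ}

theorem natCast_zmod_inj {i j : ℕ} (hi : i < n) (hj : j < n) (h : (i : ZMod n) = j) : i = j := by
  rwa [ZMod.natCast_eq_natCast_iff', Nat.mod_eq_of_lt hi, Nat.mod_eq_of_lt hj] at h

theorem window_injective (hn : 3 ≤ n) : (window n).Injective := by
  rintro ⟨a, b⟩ ⟨c, d⟩ h
  rw [window, window, Prod.mk.injEq] at h
  have h1 := natCast_zmod_inj (a.2.trans_le hn) (c.2.trans_le hn) h.1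
  have h2 := natCast_zmod_inj (b.2.trans_le hn) (d.2.trans_le hn) h.2
  exact Prod.ext (Fin.ext h1) (Fin.ext h2)

theorem window_sub_mem {v w : Fin 3 × Fin 3} (h : windowAdj v w) :
    window n w - window n v ∈ (displacements n : Set (ZMod n × ZMod n)) := by
  have e : ∀ i j : Fin 3, (i : ℕ) + 1 = j → ((j : ℕ) : ZMod n) = (i : ℕ) + 1 := fun i j h => by
    rw [← h]; push_cast; rfl
  rcases h with ⟨h1, h2 | h2⟩ | ⟨h1, h2 | h2⟩ <;>
    simp [window, displacements, h1, e _ _ h2]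

theorem mem_pow_of_window_path {l : List (Fin 3 × Fin 3)} {w : Fin 3 × Fin 3}
    (hl : List.IsChain windowAdj ((0, 0) :: l)) (hw : ((0, 0) :: l).getLast? = some w) :
    (Equiv.addRight (-window n w) * pathPerm (window n (0, 0)) (l.map (window n)),
      Multiplicative.ofAdd (window n w))
      ∈ (shiftStep '' (displacements n : Set (ZMod n × ZMod n))) ^ l.length := by
  have h0 : window n (0, 0) = 0 := by simp [window]
  have e : (0 : ZMod n × ZMod n) :: l.map (window n) = ((0, 0) :: l).map (window n) := by
    rw [List.map_cons, h0]
  rw [h0, ← List.length_map (window n)]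
  refine mem_pow_of_path_zero ?_ ?_
  · rw [e, List.isChain_map]
    exact hl.imp fun v w h => window_sub_mem h
  · rw [e, List.getLast?_map, hw]
    rfl

theorem cyc_mem_of_window_path (hn : 3 ≤ n) {l : List (Fin 3 × Fin 3)} {p : Fin 3 × Fin 3}
    (hl : List.IsChain windowAdj ((0, 0) :: l)) (hw : ((0, 0) :: l).getLast? = some (0, 0))
    (hp : ∀ x, pathPerm (0, 0) l x = cyc (1, 0) (0, 1) p x) :
    (cyc (1, 0) (0, 1) (window n p), 1)
      ∈ (shiftStep '' (displacements n : Set (ZMod n × ZMod n))) ^ l.length := by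
  have h0 : window n (0, 0) = 0 := by simp [window]
  have ha : window n (1, 0) = (1, 0) := by simp [window]
  have hb : window n (0, 1) = (0, 1) := by simp [window]
  have h := mem_pow_of_window_path (n := n) hl hw
  rwa [pathPerm_map_eq_cyc (window_injective hn) hp, h0, neg_zero, Equiv.addRight_zero, one_mul,
    ofAdd_zero, ha, hb] at h

theorem one_mem_steps : (1 : Perm (ZMod n × ZMod n) × Multiplicative (ZMod n × ZMod n))
    ∈ shiftStep '' (displacements n : Set (ZMod n × ZMod n)) :=
  ⟨0, by rw [displacements]; exact mem_coe.2 (mem_insert_self _ _), shiftStep_zero⟩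

theorem inv_mem_steps_pow (L : ℕ) {x : Perm (ZMod n × ZMod n) × Multiplicative (ZMod n × ZMod n)}
    (hx : x ∈ (shiftStep '' (displacements n : Set (ZMod n × ZMod n))) ^ L) :
    x⁻¹ ∈ (shiftStep '' (displacements n : Set (ZMod n × ZMod n))) ^ L := by
  have h1 : ∀ y ∈ shiftStep '' (displacements n : Set (ZMod n × ZMod n)),
      y⁻¹ ∈ shiftStep '' (displacements n : Set (ZMod n × ZMod n)) := by
    rintro _ ⟨d, hd, rfl⟩
    refine ⟨-d, ?_, shiftStep_neg d⟩
    simp only [displacements, coe_insert, coe_singleton, Set.mem_insert_iff,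
      Set.mem_singleton_iff] at hd ⊢
    rcases hd with rfl | rfl | rfl | rfl | rfl <;> simp
  have h2 : (shiftStep '' (displacements n : Set (ZMod n × ZMod n)))⁻¹
      = shiftStep '' (displacements n : Set (ZMod n × ZMod n)) := by
    ext y
    exact ⟨fun hy => by simpa using h1 _ hy, fun hy => h1 _ hy⟩
  rw [← h2, inv_pow]
  simpa using hx

theorem cyc_mem_of_translate (hn : 3 ≤ n) {l : List (Fin 3 × Fin 3)} {w : Fin 3 × Fin 3}
    (hl : List.IsChain windowAdj ((0, 0) :: l)) (hw : ((0, 0) :: l).getLast? = some w)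
    (ha : window n (pathPerm (0, 0) l (1, 0)) = window n (1, 0) + window n w)
    (hb : window n (pathPerm (0, 0) l (0, 1)) = window n (0, 1) + window n w)
    {q p : ZMod n × ZMod n} (hpq : p = q + window n w) (hp : ∀ x, p ≠ window n x) {L : ℕ}
    (hq : (cyc (1, 0) (0, 1) q, 1)
      ∈ (shiftStep '' (displacements n : Set (ZMod n × ZMod n))) ^ L) :
    (cyc (1, 0) (0, 1) p, 1)
      ∈ (shiftStep '' (displacements n : Set (ZMod n × ZMod n))) ^ (l.length + L + l.length) := by
  have ha' : window n (1, 0) = (1, 0) := by simp [window]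
  have hb' : window n (0, 1) = (0, 1) := by simp [window]
  have h := mem_pow_of_window_path (n := n) hl hw
  set τ := Equiv.addRight (-window n w) * pathPerm (window n (0, 0)) (l.map (window n))
  have t1 : τ (1, 0) = (1, 0) := by
    rw [← ha', Perm.mul_apply, pathPerm_map (window_injective hn), ha]
    simp
  have t2 : τ (0, 1) = (0, 1) := by
    rw [← hb', Perm.mul_apply, pathPerm_map (window_injective hn), hb]
    simp
  have t3 : τ p = q := by
    rw [Perm.mul_apply, pathPerm_map_of_notMem _ _ hp, hpq]
    simp
  have e := cyc_conj τ⁻¹ (1, 0) (0, 1) q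
  rw [Perm.inv_eq_iff_eq.2 t1.symm, Perm.inv_eq_iff_eq.2 t2.symm, Perm.inv_eq_iff_eq.2 t3.symm,
    inv_inv] at e
  have : (cyc (1, 0) (0, 1) p, (1 : Multiplicative (ZMod n × ZMod n)))
      = (τ, Multiplicative.ofAdd (window n w))⁻¹ * (cyc (1, 0) (0, 1) q, 1)
        * (τ, Multiplicative.ofAdd (window n w)) := by
    rw [← e]; simp
  rw [this, pow_add, pow_add]
  exact Set.mul_mem_mul (Set.mul_mem_mul (inv_mem_steps_pow _ h) hq) h

theorem cyc_mem_steps_pow (hn : 3 ≤ n) (s : ℕ) : ∀ i j : ℕ, i + j = s → i < n → j < n → 1 ≤ i + j →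
    (i, j) ≠ (1, 0) → (i, j) ≠ (0, 1) → (cyc (1, 0) (0, 1) ((i : ZMod n), (j : ZMod n)), 1)
      ∈ (shiftStep '' (displacements n : Set (ZMod n × ZMod n))) ^ (20 + 18 * s) := by
  induction s using Nat.strong_induction_on with
  | _ s ih =>
  intro i j hs hi hj h0 h1 h2
  have mono : ∀ {k m : ℕ} {u : Perm (ZMod n × ZMod n) × Multiplicative (ZMod n × ZMod n)}, k ≤ m →
      u ∈ (shiftStep '' (displacements n : Set (ZMod n × ZMod n))) ^ k →
      u ∈ (shiftStep '' (displacements n : Set (ZMod n × ZMod n))) ^ m :=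
    fun hk hu => Set.pow_subset_pow_right one_mem_steps hk hu
  by_cases hj3 : 3 ≤ j
  · refine mono ?_ (cyc_mem_of_translate hn (w := (0, 1))
      (l := [(1, 0), (1, 1), (1, 2), (0, 2), (0, 1), (0, 0), (1, 0), (1, 1), (0, 1)])
      (q := ((i : ZMod n), ((j - 1 : ℕ) : ZMod n))) (by decide) (by decide) ?_ ?_ ?_ ?_
      (ih (s - 1) (by omega) i (j - 1) (by omega) hi (by omega) (by omega) ?_ ?_))
    · simp only [List.length_cons, List.length_nil]
      omega
    · rw [show pathPerm _ _ _ = ((1, 1) : Fin 3 × Fin 3) by decide]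
      simp [window]
    · rw [show pathPerm _ _ _ = ((0, 2) : Fin 3 × Fin 3) by decide]
      simp [window]; norm_num
    · rw [Nat.cast_sub (by omega)]
      simp [window]
    · rintro ⟨a, b⟩ h
      have := natCast_zmod_inj hj (b.2.trans_le hn) (congrArg Prod.snd h)
      omega
    · rw [Ne, Prod.mk.injEq]; omega
    · rw [Ne, Prod.mk.injEq]; omega
  by_cases hi3 : 3 ≤ i
  · refine mono ?_ (cyc_mem_of_translate hn (w := (1, 0))
      (l := [(0, 1), (1, 1), (2, 1), (2, 0), (1, 0), (0, 0), (0, 1), (1, 1), (1, 0)])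
      (q := (((i - 1 : ℕ) : ZMod n), (j : ZMod n))) (by decide) (by decide) ?_ ?_ ?_ ?_
      (ih (s - 1) (by omega) (i - 1) j (by omega) (by omega) hj (by omega) ?_ ?_))
    · simp only [List.length_cons, List.length_nil]
      omega
    · rw [show pathPerm _ _ _ = ((2, 0) : Fin 3 × Fin 3) by decide]
      simp [window]; norm_num
    · rw [show pathPerm _ _ _ = ((1, 1) : Fin 3 × Fin 3) by decide]
      simp [window]
    · rw [Nat.cast_sub (by omega)]
      simp [window]
    · rintro ⟨a, b⟩ h
      have := natCast_zmod_inj hi (a.2.trans_le hn) (congrArg Prod.fst h)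
      omega
    · rw [Ne, Prod.mk.injEq]; omega
    · rw [Ne, Prod.mk.injEq]; omega
  have base : ∀ (l : List (Fin 3 × Fin 3)) (p : Fin 3 × Fin 3), l.length ≤ 20 →
      window n p = ((i : ZMod n), (j : ZMod n)) → List.IsChain windowAdj ((0, 0) :: l) →
      ((0, 0) :: l).getLast? = some (0, 0) →
      (∀ x, pathPerm (0, 0) l x = cyc (1, 0) (0, 1) p x) →
      (cyc (1, 0) (0, 1) ((i : ZMod n), (j : ZMod n)), 1)
        ∈ (shiftStep '' (displacements n : Set (ZMod n × ZMod n))) ^ (20 + 18 * s) := by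
    intro l p hlen hp hl hw hx
    rw [← hp]
    exact mono (by omega) (cyc_mem_of_window_path hn hl hw hx)
  have hi2 : i ≤ 2 := by omega
  have hj2 : j ≤ 2 := by omega
  interval_cases i <;> interval_cases j
  · exact absurd h0 (by norm_num)
  · exact absurd rfl h2
  · exact base [(0, 1), (0, 2), (1, 2), (1, 1), (0, 1), (0, 0), (1, 0), (1, 1), (1, 2), (0, 2),
      (0, 1), (0, 0)] (0, 2) (by decide) rfl (by decide) rfl (by decide +kernel)
  · exact absurd rfl h1
  · exact base [(1, 0), (1, 1), (0, 1), (0, 0)] (1, 1) (by decide) rfl (by decide) rfl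
      (by decide +kernel)
  · exact base [(0, 1), (1, 1), (1, 2), (0, 2), (0, 1), (0, 0), (1, 0), (1, 1), (0, 1), (0, 2),
      (1, 2), (1, 1), (0, 1), (0, 0)] (1, 2) (by decide) rfl (by decide) rfl (by decide +kernel)
  · exact base [(1, 0), (2, 0), (2, 1), (1, 1), (0, 1), (0, 0), (1, 0), (1, 1), (2, 1), (2, 0),
      (1, 0), (0, 0)] (2, 0) (by decide) rfl (by decide) rfl (by decide +kernel)
  · exact base [(1, 0), (1, 1), (2, 1), (2, 0), (1, 0), (1, 1), (0, 1), (0, 0), (1, 0), (2, 0),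
      (2, 1), (1, 1), (1, 0), (0, 0)] (2, 1) (by decide) rfl (by decide) rfl (by decide +kernel)
  · exact base [(1, 0), (2, 0), (2, 1), (1, 1), (0, 1), (0, 2), (1, 2), (2, 2), (2, 1), (1, 1),
      (1, 2), (2, 2), (2, 1), (2, 0), (1, 0), (1, 1), (1, 2), (0, 2), (0, 1), (0, 0)] (2, 2)
      (by decide) rfl (by decide) rfl (by decide +kernel)

theorem cyc_mem_steps_pow_of_ne_zero [NeZero n] (hn : 3 ≤ n) {x y z : ZMod n × ZMod n} (hx : x ≠ 0)
    (hy : y ≠ 0) (hz : z ≠ 0) (hxy : x ≠ y) (hxz : x ≠ z) (hyz : y ≠ z) :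
    (cyc x y z, 1) ∈ (shiftStep '' (displacements n : Set (ZMod n × ZMod n))) ^ (180 * n) := by
  have : Fact (1 < n) := ⟨by omega⟩
  rw [show 180 * n = 36 * n * 5 by ring, pow_mul]
  refine cyc_mem_of_cyc_mem (p := fun z => z ≠ 0) (a := (1, 0)) (b := (0, 1))
    (Set.one_mem_pow one_mem_steps) (fun x hx => inv_mem_steps_pow _ hx) (by simp) ?_ hx hy hz
    hxy hxz hyz
  rintro ⟨u, v⟩ h0 ha hb
  have hu := ZMod.val_lt u
  have hv := ZMod.val_lt v
  have h := cyc_mem_steps_pow hn _ u.val v.val rfl hu hv ?_ ?_ ?_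
  · rw [ZMod.natCast_zmod_val, ZMod.natCast_zmod_val] at h
    exact Set.pow_subset_pow_right one_mem_steps (by omega) h
  · by_contra hlt
    have h1 : u.val = 0 := by omega
    have h2 : v.val = 0 := by omega
    rw [ZMod.val_eq_zero] at h1 h2
    exact h0 (by rw [h1, h2]; rfl)
  · intro h
    rw [Prod.mk.injEq, ZMod.val_eq_one (by omega), ZMod.val_eq_zero] at h
    exact ha (by rw [h.1, h.2])
  · intro h
    rw [Prod.mk.injEq, ZMod.val_eq_one (by omega), ZMod.val_eq_zero] at h
    exact hb (by rw [h.1, h.2])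

end Board

section Walk

open scoped Pointwise

variable {Γ : Type*} [Group Γ] [Fintype Γ] [DecidableEq Γ]

theorem walk_apply (S : Finset Γ) (x y : Γ) :
    walk S x y = (#S : ℝ)⁻¹ * #{s ∈ S | x = s * y} := by
  simp [walk, Matrix.sum_apply, regRep_apply]

theorem walk_pow_succ_apply_one (S : Finset Γ) (N : ℕ) (x : Γ) :
    (walk S ^ (N + 1)) x 1 = (#S : ℝ)⁻¹ * ∑ s ∈ S, (walk S ^ N) (s⁻¹ * x) 1 := by
  have h : ∀ s, ∑ y, regRep s x y * (walk S ^ N) y 1 = (walk S ^ N) (s⁻¹ * x) 1 := fun s => by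
    rw [sum_eq_single (s⁻¹ * x)]
    · rw [regRep_apply, mul_inv_cancel_left, if_pos rfl, one_mul]
    · intro y _ hy
      rw [regRep_apply, if_neg, zero_mul]
      rintro rfl
      exact hy (inv_mul_cancel_left _ _).symm
    · simp
  simp_rw [← h]
  rw [pow_succ', Matrix.mul_apply, sum_comm, mul_sum]
  refine sum_congr rfl fun y _ => ?_
  rw [walk, Matrix.smul_apply, Matrix.sum_apply, smul_eq_mul, mul_assoc, sum_mul]

theorem walk_pow_apply_one_pos_iff {S : Finset Γ} (hS : S.Nonempty) (N : ℕ) (x : Γ) :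
    0 ≤ (walk S ^ N) x 1 ∧ (0 < (walk S ^ N) x 1 ↔ x ∈ (S : Set Γ) ^ N) := by
  have hc : 0 < (#S : ℝ)⁻¹ := inv_pos.2 (by exact_mod_cast hS.card_pos)
  induction N generalizing x with
  | zero =>
    rw [pow_zero, pow_zero, Matrix.one_apply, Set.mem_one]
    split_ifs with h <;> simp [h]
  | succ N ih =>
    have h0 : ∀ s ∈ S, 0 ≤ (walk S ^ N) (s⁻¹ * x) 1 := fun s _ => (ih _).1
    rw [walk_pow_succ_apply_one]
    refine ⟨mul_nonneg hc.le (sum_nonneg h0), ?_⟩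
    rw [mul_pos_iff_of_pos_left hc, sum_pos_iff_of_nonneg h0, pow_succ', Set.mem_mul]
    constructor
    · rintro ⟨s, hs, h⟩
      exact ⟨s, hs, s⁻¹ * x, (ih _).2.1 h, mul_inv_cancel_left _ _⟩
    · rintro ⟨s, hs, y, hy, rfl⟩
      exact ⟨s, hs, by rw [inv_mul_cancel_left]; exact (ih _).2.2 hy⟩

end Walk

section Reduction

open Equiv
open scoped Pointwise

variable {V : Type*} [DecidableEq V] [AddCommGroup V] {m : ℕ} (e : Fin m ≃ {v : V // v ≠ 0})

/-- The pairs whose permutation fixes the center, inside all pairs. -/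
def centered : Perm (Fin m) × Multiplicative V →* Perm V × Multiplicative V :=
  (Perm.extendDomainHom e).prodMap (MonoidHom.id _)

theorem centered_apply (κ : Perm (Fin m) × Multiplicative V) :
    centered e κ = (κ.1.extendDomain e, κ.2) := rfl

theorem centered_injective : Function.Injective (centered e) := by
  rintro ⟨ρ, v⟩ ⟨ρ', v'⟩ h
  rw [centered_apply, centered_apply, Prod.mk.injEq] at h
  exact Prod.ext (Perm.extendDomainHom_injective e h.1) h.2

theorem extendDomain_zero (ρ : Perm (Fin m)) : ρ.extendDomain e 0 = 0 :=
  Perm.extendDomain_apply_not_subtype _ _ (by simp)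

theorem exists_centered_eq_shiftStep (d : V) : ∃ κ, centered e κ = shiftStep d := by
  set π : Perm V := Equiv.addRight (-d) * swap 0 d
  have h0 : π 0 = 0 := by simp [π]
  have h : ∀ x, π x ≠ 0 ↔ x ≠ 0 := fun x => by
    rw [not_iff_not]
    constructor
    · exact fun hx => π.injective (hx.trans h0.symm)
    · rintro rfl; exact h0
  refine ⟨(e.symm.permCongr (π.subtypePerm h), Multiplicative.ofAdd d), ?_⟩
  rw [centered_apply, shiftStep]
  congr 1
  ext x
  by_cases hx : x = 0
  · subst hx
    rw [extendDomain_zero]; exact h0.symm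
  · rw [Perm.extendDomain_apply_subtype (p := fun v => v ≠ 0) _ _ hx]
    simp [π]

theorem centered_cyc (i j k : Fin m) :
    centered e (cyc i j k, 1) = (cyc (e i : V) (e j) (e k), 1) := by
  have hs : ∀ i j : Fin m, (swap i j).extendDomain e = swap (e i : V) (e j) := by
    intro i j
    have he : (fun i => (e i : V)).Injective := Subtype.val_injective.comp e.injective
    ext x
    by_cases hx : x = 0
    · subst hx
      rw [extendDomain_zero, swap_apply_of_ne_of_ne (e i).2.symm (e j).2.symm]
    · obtain ⟨y, hy⟩ := e.surjective ⟨x, hx⟩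
      obtain rfl : (e y : V) = x := by rw [hy]
      rw [Perm.extendDomain_apply_image, ← he.swap_apply]
  rw [centered_apply, cyc, cyc, ← Perm.extendDomain_mul, hs, hs]

/-- The arrangement with given center and given arrangement relative to the center. -/
def arrangement (b : V) (κ : Perm (Fin m) × Multiplicative V) : Perm V :=
  Equiv.addRight (κ.2.toAdd + b) * κ.1.extendDomain e * Equiv.addRight (-b)

theorem arrangement_apply_self (b : V) (κ : Perm (Fin m) × Multiplicative V) :
    arrangement e b κ b = κ.2.toAdd + b := by
  simp [arrangement, extendDomain_zero]

theorem arrangement_one (b : V) : arrangement e b 1 = 1 := by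
  ext x
  simp [arrangement]

theorem arrangement_injective (b : V) : (arrangement e b).Injective := by
  rintro ⟨ρ, v⟩ ⟨ρ', v'⟩ h
  obtain rfl : v = v' := by
    have := congrArg (fun π => π b) h
    simp only [arrangement_apply_self, add_left_inj] at this
    exact this
  rw [arrangement, arrangement, mul_left_inj, mul_right_inj] at h
  exact Prod.ext (Perm.extendDomainHom_injective e h) rfl

theorem arrangement_bijective [Fintype V] (b : V) : (arrangement e b).Bijective := by
  rw [Fintype.bijective_iff_injective_and_card]
  refine ⟨arrangement_injective e b, ?_⟩
  have hm : m = Fintype.card V - 1 := by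
    rw [← Fintype.card_fin m, Fintype.card_congr e,
      Fintype.card_subtype_compl (fun v => v = (0 : V)),
      Fintype.card_subtype_eq]
  rw [Fintype.card_prod, Fintype.card_perm, Fintype.card_perm, Fintype.card_fin, hm,
    Fintype.card_multiplicative, mul_comm, Nat.mul_factorial_pred Fintype.card_ne_zero]

theorem arrangement_mul (b d : V) {s : Perm (Fin m) × Multiplicative V}
    (hs : centered e s = shiftStep d) (κ : Perm (Fin m) × Multiplicative V) :
    arrangement e b (s * κ)
      = swap (arrangement e b κ b) (arrangement e b κ b + d) * arrangement e b κ := by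
  rw [centered_apply, shiftStep, Prod.mk.injEq] at hs
  have h := swap_apply_apply (Equiv.addRight (κ.2.toAdd + b)) 0 d
  have h1 : (Equiv.addRight (κ.2.toAdd + b)) 0 = κ.2.toAdd + b := by simp
  have h2 : (Equiv.addRight (κ.2.toAdd + b)) d = κ.2.toAdd + b + d := by
    simp only [coe_addRight]
    abel
  have h3 : (Equiv.addRight (d + (κ.2.toAdd + b)) * Equiv.addRight (-d) : Perm V)
      = Equiv.addRight (κ.2.toAdd + b) := by
    ext x
    simp [add_assoc]
  rw [h1, h2] at h
  rw [arrangement_apply_self, h, arrangement, arrangement, Prod.fst_mul, Prod.snd_mul,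
    ← Perm.extendDomain_mul, hs.1, hs.2, toAdd_mul, toAdd_ofAdd, add_assoc, ← h3]
  group

end Reduction

section Puzzle

open Equiv
open scoped Pointwise

variable {n : ℕ}

theorem card_displacements (hn : 3 ≤ n) : #(displacements n) = 5 := by
  have : Fact (1 < n) := ⟨by omega⟩
  have h : (1 : ZMod n) ≠ -1 := fun h => by
    have h2 : ((2 : ℕ) : ZMod n) = (0 : ℕ) := by
      push_cast
      linear_combination h
    exact absurd (natCast_zmod_inj (by omega) (by omega) h2) (by norm_num)
  simp [displacements, h, Prod.ext_iff]

theorem log_three_gt_one : 1 < Real.log 3 := by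
  rw [Real.lt_log_iff_exp_lt (by norm_num)]
  exact Real.exp_one_lt_d9.trans (by norm_num)

theorem half_mul_sqrt_add_sqrt_le_inv_exp_one (hn : 3 ≤ n) {N : ℕ}
    (hN : 8100000 * (n : ℝ) ^ 4 * Real.log n ≤ N) {m : ℕ} (hm : m + 1 = n ^ 2) :
    (1 / 2) * (√(2 * (n ^ 2 : ℝ) *
          (Real.exp ((m : ℝ) ^ 2 * Real.exp (-(1 / ((5 : ℝ) ^ 2 * (180 * n) ^ 2 * m) * N))) - 1))
        + √(2 * (n ^ 2 : ℝ) * (1 - 1 / (2 * n ^ 2 * 5 : ℝ) ^ 2) ^ N)) ≤ (Real.exp 1)⁻¹ := by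
  have hn3 : (3 : ℝ) ≤ n := by exact_mod_cast hn
  have hn0 : (0 : ℝ) < n := by linarith
  have hlog : 1 < Real.log n := log_three_gt_one.trans_le (Real.log_le_log (by norm_num) hn3)
  have hmn : (m : ℝ) + 1 = n ^ 2 := by exact_mod_cast hm
  have hm0 : (0 : ℝ) < m := by nlinarith
  have hexp : ∀ k : ℕ, Real.exp (-(k * Real.log n)) = ((n : ℝ) ^ k)⁻¹ := fun k => by
    rw [Real.exp_neg, Real.exp_nat_mul, Real.exp_log hn0]
  have h1 : (10 : ℕ) * Real.log n ≤ 1 / ((5 : ℝ) ^ 2 * (180 * n) ^ 2 * m) * N := by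
    rw [one_div, inv_mul_eq_div, le_div_iff₀ (by positivity)]
    refine le_trans ?_ hN
    have : (n : ℝ) ^ 2 * m ≤ n ^ 4 := by nlinarith [sq_nonneg (n : ℝ)]
    push_cast
    nlinarith
  have h2 : (m : ℝ) ^ 2 * Real.exp (-(1 / ((5 : ℝ) ^ 2 * (180 * n) ^ 2 * m) * N))
      ≤ ((n : ℝ) ^ 6)⁻¹ := by
    calc (m : ℝ) ^ 2 * Real.exp (-(1 / ((5 : ℝ) ^ 2 * (180 * n) ^ 2 * m) * N))
        ≤ (n ^ 2 : ℝ) ^ 2 * ((n : ℝ) ^ 10)⁻¹ := by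
          rw [← hexp]
          gcongr
          linarith
      _ = ((n : ℝ) ^ 6)⁻¹ := by field_simp
  have h6 : ((n : ℝ) ^ 6)⁻¹ ≤ 1 / 729 := by
    rw [one_div]
    gcongr
    calc (729 : ℝ) = 3 ^ 6 := by norm_num
      _ ≤ n ^ 6 := by gcongr
  have h4 : ((n : ℝ) ^ 4)⁻¹ ≤ 1 / 81 := by
    rw [one_div]
    gcongr
    calc (81 : ℝ) = 3 ^ 4 := by norm_num
      _ ≤ n ^ 4 := by gcongr
  have h26 : 2 * (n ^ 2 : ℝ) * ((n : ℝ) ^ 6)⁻¹ = 2 * ((n : ℝ) ^ 4)⁻¹ := by field_simp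
  have h3 : Real.exp ((m : ℝ) ^ 2 * Real.exp (-(1 / ((5 : ℝ) ^ 2 * (180 * n) ^ 2 * m) * N))) - 1
      ≤ 2 * ((n : ℝ) ^ 6)⁻¹ := by
    refine (sub_le_sub_right (Real.exp_le_exp.2 h2) 1).trans ?_
    have h0 : 0 ≤ ((n : ℝ) ^ 6)⁻¹ := by positivity
    have := Real.abs_exp_sub_one_le (x := ((n : ℝ) ^ 6)⁻¹) (by rw [abs_of_nonneg h0]; linarith)
    rw [abs_of_nonneg h0] at this
    exact (le_abs_self _).trans this
  have h5 : (1 - 1 / (2 * n ^ 2 * 5 : ℝ) ^ 2) ^ N ≤ ((n : ℝ) ^ 6)⁻¹ := by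
    rw [← hexp]
    have hd : 1 / (2 * n ^ 2 * 5 : ℝ) ^ 2 ≤ 1 := by
      rw [div_le_one (by positivity)]
      have : (9 : ℝ) ≤ n ^ 2 := by nlinarith
      nlinarith
    calc (1 - 1 / (2 * n ^ 2 * 5 : ℝ) ^ 2) ^ N
        ≤ Real.exp (-(1 / (2 * n ^ 2 * 5 : ℝ) ^ 2)) ^ N :=
          pow_le_pow_left₀ (by linarith) (Real.one_sub_le_exp_neg _) N
      _ = Real.exp (-(N / (2 * n ^ 2 * 5 : ℝ) ^ 2)) := by
          rw [← Real.exp_nat_mul]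
          ring_nf
      _ ≤ Real.exp (-((6 : ℕ) * Real.log n)) := by
          gcongr
          rw [le_div_iff₀ (by positivity)]
          refine le_trans ?_ hN
          have : 0 < (n : ℝ) ^ 4 * Real.log n := by positivity
          push_cast
          nlinarith
  have s1 : √(2 * (n ^ 2 : ℝ) *
      (Real.exp ((m : ℝ) ^ 2 * Real.exp (-(1 / ((5 : ℝ) ^ 2 * (180 * n) ^ 2 * m) * N))) - 1))
        ≤ 1 / 4 := by
    rw [Real.sqrt_le_left (by norm_num)]
    calc _ ≤ 2 * (n ^ 2 : ℝ) * (2 * ((n : ℝ) ^ 6)⁻¹) := by gcongr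
      _ ≤ _ := by linarith
  have s2 : √(2 * (n ^ 2 : ℝ) * (1 - 1 / (2 * n ^ 2 * 5 : ℝ) ^ 2) ^ N) ≤ 1 / 4 := by
    rw [Real.sqrt_le_left (by norm_num)]
    calc _ ≤ 2 * (n ^ 2 : ℝ) * ((n : ℝ) ^ 6)⁻¹ := by gcongr
      _ ≤ _ := by linarith
  have he : 1 / 4 ≤ (Real.exp 1)⁻¹ := by
    rw [one_div]
    gcongr
    exact Real.exp_one_lt_d9.le.trans (by norm_num)
  linarith

variable {m : ℕ} (e : Fin m ≃ {v : ZMod n × ZMod n // v ≠ 0})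
  {s : ZMod n × ZMod n → Perm (Fin m) × Multiplicative (ZMod n × ZMod n)}

include e in
theorem centeredSteps_injective (hs : ∀ d, centered e (s d) = shiftStep d) : s.Injective := by
  intro d d' h
  have := (hs d).symm.trans ((congrArg (centered e) h).trans (hs d'))
  exact Multiplicative.ofAdd.injective (Prod.ext_iff.1 this).2

theorem centered_image (hs : ∀ d, centered e (s d) = shiftStep d) (L : ℕ) :
    centered e '' (((displacements n).image s : Finset _) : Set _) ^ L
      = (shiftStep '' (displacements n : Set (ZMod n × ZMod n))) ^ L := by
  rw [Set.image_pow, coe_image, Set.image_image]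
  simp_rw [hs]

variable [NeZero n]

theorem puzzleStep_arrangement (hn : 3 ≤ n) (hs : ∀ d, centered e (s d) = shiftStep d)
    (κ κ' : Perm (Fin m) × Multiplicative (ZMod n × ZMod n)) :
    puzzleStep n (arrangement e (emptyLabel n) κ) (arrangement e (emptyLabel n) κ')
      = walk ((displacements n).image s) κ' κ := by
  have hinj := centeredSteps_injective e hs
  rw [puzzleStep, walk_apply, card_image_of_injective _ hinj, card_displacements hn, filter_image,
    card_image_of_injective _ hinj, Nat.cast_ofNat, one_div]
  congr 2
  refine congrArg card ?_
  ext d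
  refine (@mem_filter _ _ (_) _ _).trans (Iff.trans ?_ mem_filter.symm)
  rw [← arrangement_mul e _ d (hs d), (arrangement_injective e _).eq_iff]

theorem puzzleDist_arrangement (hn : 3 ≤ n) (hs : ∀ d, centered e (s d) = shiftStep d) (N : ℕ)
    (κ : Perm (Fin m) × Multiplicative (ZMod n × ZMod n)) :
    puzzleDist n N (arrangement e (emptyLabel n) κ) =
      (walk ((displacements n).image s) ^ N) κ 1 := by
  induction N generalizing κ with
  | zero =>
    rw [puzzleDist, pow_zero, Matrix.one_apply]
    refine if_congr ?_ rfl rfl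
    rw [← arrangement_one e (emptyLabel n), (arrangement_injective e _).eq_iff]
  | succ N ih =>
    rw [pow_succ', Matrix.mul_apply]
    simp only [puzzleDist]
    rw [← (arrangement_bijective e (emptyLabel n)).sum_comp]
    refine sum_congr rfl fun κ' _ => ?_
    rw [ih, puzzleStep_arrangement e hn hs, mul_comm]

theorem reachable_eq_image (hn : 3 ≤ n) (hs : ∀ d, centered e (s d) = shiftStep d)
    (hinv : ∀ x ∈ (displacements n).image s, x⁻¹ ∈ (displacements n).image s) :
    reachable n = arrangement e (emptyLabel n) ''
      {κ | κ ∈ Subgroup.closure (((displacements n).image s : Finset _) : Set _)} := by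
  have hne : ((displacements n).image s).Nonempty :=
    image_nonempty.2 (card_pos.1 (by rw [card_displacements hn]; norm_num))
  ext σ
  obtain ⟨κ, rfl⟩ := (arrangement_bijective e (emptyLabel n)).2 σ
  rw [(arrangement_injective e _).mem_set_image, Set.mem_ofPred_eq,
    mem_closure_iff_exists_pow hinv, reachable, Set.mem_ofPred_eq]
  simp_rw [puzzleDist_arrangement e hn hs, (walk_pow_apply_one_pos_iff hne _ _).2]

theorem sum_abs_puzzleDist_sub_le (hn : 3 ≤ n) {N : ℕ}
    (hN : 8100000 * (n : ℝ) ^ 4 * Real.log n ≤ N) :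
    (1 / 2) * ∑ σ : Equiv.Perm (ZMod n × ZMod n),
        Set.indicator (reachable n)
          (fun σ => |puzzleDist n N σ - ((reachable n).ncard : ℝ)⁻¹|) σ
      ≤ (Real.exp 1)⁻¹ := by
  have hV : Fintype.card (ZMod n × ZMod n) = n ^ 2 := by
    rw [Fintype.card_prod, ZMod.card, sq]
  have hn2 : 3 ^ 2 ≤ n ^ 2 := Nat.pow_le_pow_left hn 2
  set m := n ^ 2 - 1 with hm
  have e : Fin m ≃ {v : ZMod n × ZMod n // v ≠ 0} := by
    refine Fintype.equivOfCardEq ?_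
    rw [Fintype.card_fin, Fintype.card_subtype_compl (fun v => v = (0 : ZMod n × ZMod n)),
      Fintype.card_subtype_eq, hV]
  choose s hs using exists_centered_eq_shiftStep e
  set S := (displacements n).image s with hS
  have hSimg : ∀ {L κ}, κ ∈ (S : Set _) ^ L ↔
      centered e κ ∈ (shiftStep '' (displacements n : Set (ZMod n × ZMod n))) ^ L := by
    intro L κ
    rw [← centered_image e hs, (centered_injective e).mem_set_image]
  have h1 : 1 ∈ S := by
    have := (hSimg (L := 1) (κ := 1)).2 (by rw [pow_one, map_one]; exact one_mem_steps)
    rwa [pow_one, mem_coe] at this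
  have hinv : ∀ x ∈ S, x⁻¹ ∈ S := fun x hx => by
    have hx' := (hSimg (L := 1) (κ := x)).1 (by rwa [pow_one, mem_coe])
    have := (hSimg (L := 1) (κ := x⁻¹)).2 (by rw [map_inv]; exact inv_mem_steps_pow _ hx')
    rwa [pow_one, mem_coe] at this
  have hScard : #S = 5 := by
    rw [hS, card_image_of_injective _ (centeredSteps_injective e hs), card_displacements hn]
  classical
  set G := Subgroup.closure (S : Set (Perm (Fin m) × Multiplicative (ZMod n × ZMod n))) with hG
  have hcyc : ∀ i j k : Fin m, i ≠ j → i ≠ k → j ≠ k →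
      (cyc i j k, (1 : Multiplicative (ZMod n × ZMod n))) ∈ (S : Set _) ^ (180 * n) := by
    intro i j k hij hik hjk
    rw [hSimg, centered_cyc]
    have he : ∀ {i j}, i ≠ j → (e i : ZMod n × ZMod n) ≠ e j := fun h h' =>
      h (e.injective (Subtype.ext h'))
    exact cyc_mem_steps_pow_of_ne_zero hn (e i).2 (e j).2 (e k).2 (he hij) (he hik) (he hjk)
  have hN0 : N ≠ 0 := by
    rintro rfl
    have hn3 : (3 : ℝ) ≤ n := by exact_mod_cast hn
    have : 0 < Real.log n := Real.log_pos (by linarith)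
    have : 0 < 8100000 * (n : ℝ) ^ 4 * Real.log n := by positivity
    rw [Nat.cast_zero] at hN
    linarith
  have main := sum_abs_walk_pow_sub_perm_le (by omega) h1 hinv hG (by omega) hcyc hN0
  rw [Fintype.card_multiplicative, hV, hScard] at main
  have hcard : (reachable n).ncard = Fintype.card G := by
    rw [reachable_eq_image e hn hs hinv, Set.ncard_image_of_injective _ (arrangement_injective e _),
      ← Nat.card_coe_set_eq, Nat.card_eq_fintype_card]
    rfl
  have hsum : ∑ σ : Equiv.Perm (ZMod n × ZMod n), Set.indicator (reachable n)
        (fun σ => |puzzleDist n N σ - ((reachable n).ncard : ℝ)⁻¹|) σ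
      = ∑ g : G, |(walk S ^ N) g 1 - (Fintype.card G : ℝ)⁻¹| := by
    rw [hcard, ← (arrangement_bijective e (emptyLabel n)).sum_comp,
      ← sum_subtype (univ.filter (· ∈ G)) (by simp)
        fun g => |(walk S ^ N) g 1 - (Fintype.card G : ℝ)⁻¹|,
      sum_filter]
    refine sum_congr rfl fun κ _ => ?_
    rw [Set.indicator_apply, reachable_eq_image e hn hs hinv,
      (arrangement_injective e _).mem_set_image, puzzleDist_arrangement e hn hs]
    rfl
  rw [hsum]
  refine le_trans ?_ (half_mul_sqrt_add_sqrt_le_inv_exp_one hn hN (m := m) (by omega))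
  push_cast at main
  linarith

end Puzzle

end Mixing

/-- **Mixing time upper bound for the `n²−1` puzzle.**  There is a constant `C > 0` such
that for all `n ≥ 3` and all `N ≥ C n⁴ log n`, the total variation distance between the
`N`-step distribution of the puzzle chain (started at the identity) and the uniform
distribution on the set of reachable states is at most `1/e`. -/
theorem puzzle_mixing_upper_bound :
    ∃ C : ℝ, 0 < C ∧ ∀ (n : ℕ) [NeZero n], 3 ≤ n → ∀ N : ℕ,
      C * (n : ℝ) ^ 4 * Real.log n ≤ N →
      (1 / 2) * ∑ σ : Equiv.Perm (ZMod n × ZMod n),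
          Set.indicator (reachable n)
            (fun σ => |puzzleDist n N σ - ((reachable n).ncard : ℝ)⁻¹|) σ
        ≤ (Real.exp 1)⁻¹ := by
  exact ⟨8100000, by norm_num, fun n _ hn N hN => sum_abs_puzzleDist_sub_le hn hN⟩
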